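/- arXiv:2006.04789 — 5 statements merged into one kernel-verified Lean document; each statement's English description precedes it below -/
import Mathlib

section
/- Let R be a commutative noetherian ring and S a multiplicative subset of R consisting of non-zero-divisors. Let M be a finitely generated S-torsion R-module and n ≥ 0 an integer. Suppose 0 → N → P_1 → ⋯ → P_n → M → 0 and 0 → N' → P'_1 → ⋯ → P'_n → M → 0 are two exact sequences of finitely generated S-torsion R-modules with pd_R(P_i) ≤ 1 and pd_R(P'_i) ≤ 1 for all 1 ≤ i ≤ n. Then, as fractional ideals of R with respect to S, (∏_{i=1}^n Fitt_R(P_i)^{(-1)^i})·Fitt_R(N) = (∏_{i=1}^n Fitt_R(P'_i)^{(-1)^i})·Fitt_R(N'); i.e. the fractional ideal 𝓕^[n](M) = (∏_{i=1}^n Fitt_R(P_i)^{(-1)^i})·Fitt_R(N) is independent of the choice of the resolution. -/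
open CategoryTheory MulOpposite

noncomputable section

/-- `M` is `S`-torsion: every element is annihilated by some element of `S`. -/
def STorsion (R : Type) [Ring R] (S : Submonoid R) (M : Type) [AddCommGroup M] [Module R M] :
    Prop :=
  ∀ m : M, ∃ s ∈ S, s • m = 0

/-- Projective dimension `≤ n`, witnessed by resolutions with finite free stages. -/
def PdLE (R : Type) [Ring R] : ℕ → (M : Type) → [AddCommGroup M] → [Module R M] → Prop
  | 0, M, _, _ => Module.Projective R M
  | n+1, M, _, _ => ∃ (k : ℕ) (f : (Fin k → R) →ₗ[R] M),
      Function.Surjective f ∧ PdLE R n (LinearMap.ker f)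

/-- Finite projective dimension. -/
def FinitePd (R : Type) [Ring R] (M : Type) [AddCommGroup M] [Module R M] : Prop :=
  ∃ n, PdLE R n M

/-- Membership in the category `𝓜` of finitely generated `S`-torsion modules. -/
def MemM (R : Type) [Ring R] (S : Submonoid R) (M : Type) [AddCommGroup M] [Module R M] : Prop :=
  Module.Finite R M ∧ STorsion R S M

/-- Membership in `𝓟`: finitely generated `S`-torsion of projective dimension `≤ 1`. -/
def MemP (R : Type) [Ring R] (S : Submonoid R) (M : Type) [AddCommGroup M] [Module R M] : Prop :=
  MemM R S M ∧ PdLE R 1 M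

/-- Membership in `𝓠`: finitely generated `S`-torsion of finite projective dimension. -/
def MemQ (R : Type) [Ring R] (S : Submonoid R) (M : Type) [AddCommGroup M] [Module R M] : Prop :=
  MemM R S M ∧ FinitePd R M

/-- The Ext group `Ext^i_R(M, N)`. -/
abbrev extGroup (R : Type) [Ring R] (M N : Type) [AddCommGroup M] [Module R M]
    [AddCommGroup N] [Module R N] (i : ℕ) : Type :=
  (((_root_.Ext ℤ (ModuleCat R) i).obj (Opposite.op (ModuleCat.of R M))).obj (ModuleCat.of R N))

/-- Vanishing of `Ext^i_R(M, R)`. -/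
def ExtRVanish (R : Type) [Ring R] (M : Type) [AddCommGroup M] [Module R M] (i : ℕ) : Prop :=
  Subsingleton (extGroup R M R i)

/-- `pd*_R(M) ≤ 1`, i.e. `Ext^i_R(M, R) = 0` for all `i ≥ 2`. -/
def PdStarLE1 (R : Type) [Ring R] (M : Type) [AddCommGroup M] [Module R M] : Prop :=
  ∀ i, 2 ≤ i → ExtRVanish R M i

/-- Membership in `𝓒`: finitely generated `S`-torsion with `pd* ≤ 1`. -/
def MemC (R : Type) [Ring R] (S : Submonoid R) (M : Type) [AddCommGroup M] [Module R M] : Prop :=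
  MemM R S M ∧ PdStarLE1 R M

/-- Assumption (⋆): a uniform bound `d(R)` on `pd*` of all finitely generated left or
right `R`-modules. -/
def AssumptionStar (R : Type) [Ring R] : Prop :=
  ∃ d : ℕ,
    (∀ (M : Type) [AddCommGroup M] [Module R M], Module.Finite R M →
      ∀ i, d < i → ExtRVanish R M i) ∧
    (∀ (M : Type) [AddCommGroup M] [Module Rᵐᵒᵖ M], Module.Finite Rᵐᵒᵖ M →
      ∀ i, d < i → ExtRVanish Rᵐᵒᵖ M i)

/-- `S` is a (left and right) Ore set consisting of non-zero-divisors. -/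
def IsOreSet (R : Type) [Ring R] (S : Submonoid R) : Prop :=
  S ≤ nonZeroDivisors R ∧
    (∀ f ∈ S, ∀ a : R, ∃ r : R, ∃ s ∈ S, f * r = a * s) ∧
    (∀ f ∈ S, ∀ a : R, ∃ r : R, ∃ s ∈ S, r * f = s * a)

/-- A sequence of `R`-modules and maps, used to encode finite exact sequences. -/
structure ModSeq (R : Type) [Ring R] where
  C : ℕ → Type
  [acg : ∀ i, AddCommGroup (C i)]
  [mod : ∀ i, Module R (C i)]
  f : ∀ i, C i →ₗ[R] C (i+1)

attribute [instance] ModSeq.acg ModSeq.mod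

/-- `D.ExactTrunc n` : the window `0 → C 0 → C 1 → ⋯ → C (n+1) → 0` is exact. -/
def ModSeq.ExactTrunc {R : Type} [Ring R] (D : ModSeq R) (n : ℕ) : Prop :=
  Function.Injective (D.f 0) ∧ Function.Surjective (D.f n) ∧
    ∀ i < n, Function.Exact (D.f i) (D.f (i+1))

/-- The (initial) Fitting ideal of a module over a commutative ring. -/
def fittingIdeal (R : Type) [CommRing R] (M : Type) [AddCommGroup M] [Module R M] : Ideal R :=
  Ideal.span { x : R | ∃ (a : ℕ) (A : Matrix (Fin a) (Fin a) R) (π : (Fin a → R) →ₗ[R] M),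
    Function.Surjective π ∧ (∀ j, π (fun i => A i j) = 0) ∧ x = A.det }

/-- The Fitting ideal viewed as a fractional ideal, i.e. a finitely generated
`R`-submodule of `S⁻¹R`. -/
def fittFrac (R : Type) [CommRing R] (S : Submonoid R) (M : Type) [AddCommGroup M]
    [Module R M] : Submodule R (Localization S) :=
  Submodule.map (Algebra.linearMap R (Localization S)) (fittingIdeal R M)

/-- Precomposition with `ι`, as a map of right `R`-modules `Hom(F, R) → Hom(N, R)`. -/
def precompDual (R : Type) [Ring R] {N F : Type} [AddCommGroup N] [Module R N]
    [AddCommGroup F] [Module R F] (ι : N →ₗ[R] F) :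
    (F →ₗ[R] R) →ₗ[Rᵐᵒᵖ] (N →ₗ[R] R) where
  toFun g := g.comp ι
  map_add' _ _ := LinearMap.ext fun _ => rfl
  map_smul' _ _ := LinearMap.ext fun _ => rfl

/-- `Ext^1_R(M, R)` computed from a presentation `0 → N → F → M → 0` with `F` projective:
the cokernel of `Hom(F, R) → Hom(N, R)`; it is a right `R`-module. -/
abbrev ExtOneDual (R : Type) [Ring R] {N F : Type} [AddCommGroup N] [Module R N]
    [AddCommGroup F] [Module R F] (ι : N →ₗ[R] F) : Type :=
  (N →ₗ[R] R) ⧸ LinearMap.range (precompDual R ι)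

/-- Precomposition with `ι`, commutative case. -/
def precompDualComm (R : Type) [CommRing R] {N F : Type} [AddCommGroup N] [Module R N]
    [AddCommGroup F] [Module R F] (ι : N →ₗ[R] F) :
    (F →ₗ[R] R) →ₗ[R] (N →ₗ[R] R) where
  toFun g := g.comp ι
  map_add' _ _ := LinearMap.ext fun _ => rfl
  map_smul' _ _ := LinearMap.ext fun _ => rfl

/-- `Ext^1_R(M, R)` computed from a presentation, commutative case. -/
abbrev ExtOneDualComm (R : Type) [CommRing R] {N F : Type} [AddCommGroup N] [Module R N]
    [AddCommGroup F] [Module R F] (ι : N →ₗ[R] F) : Type :=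
  (N →ₗ[R] R) ⧸ LinearMap.range (precompDualComm R ι)

/-- A Fitting invariant `𝓕 : 𝓜 → Ω`. -/
def IsFittingInv (R : Type) [Ring R] (S : Submonoid R) {Ω : Type} [CommMonoid Ω]
    (F : (M : Type) → [AddCommGroup M] → [Module R M] → Ω) : Prop :=
  (∀ (P : Type) [AddCommGroup P] [Module R P], MemP R S P → IsUnit (F P)) ∧
  (∀ (M' M P : Type) [AddCommGroup M'] [Module R M'] [AddCommGroup M] [Module R M]
      [AddCommGroup P] [Module R P], MemM R S M' → MemM R S M → MemP R S P →
    ∀ (ι : M' →ₗ[R] M) (p : M →ₗ[R] P), Function.Injective ι → Function.Surjective p →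
      Function.Exact ι p → F M = F P * F M')

/-- A quasi-Fitting invariant `𝓕 : 𝓒 → Ω`. -/
def IsQuasiFittingInv (R : Type) [Ring R] (S : Submonoid R) {Ω : Type} [CommMonoid Ω]
    (F : (M : Type) → [AddCommGroup M] → [Module R M] → Ω) : Prop :=
  (∀ (P : Type) [AddCommGroup P] [Module R P], MemP R S P → IsUnit (F P)) ∧
  (∀ (M' M P : Type) [AddCommGroup M'] [Module R M'] [AddCommGroup M] [Module R M]
      [AddCommGroup P] [Module R P], MemC R S M' → MemC R S M → MemP R S P →
    ∀ (ι : M' →ₗ[R] M) (p : M →ₗ[R] P), Function.Injective ι → Function.Surjective p →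
      Function.Exact ι p → F M = F P * F M') ∧
  (∀ (P M M' : Type) [AddCommGroup P] [Module R P] [AddCommGroup M] [Module R M]
      [AddCommGroup M'] [Module R M'], MemP R S P → MemC R S M → MemC R S M' →
    ∀ (ι : P →ₗ[R] M) (p : M →ₗ[R] M'), Function.Injective ι → Function.Surjective p →
      Function.Exact ι p → F M = F P * F M')

/-- The membership predicate of `𝓜` as a family. -/
def MemMFam (R : Type) [Ring R] (S : Submonoid R) (M : Type) [AddCommGroup M] [Module R M] :
    Prop :=
  MemM R S M

/-- The membership predicate of `𝓒` as a family. -/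
def MemCFam (R : Type) [Ring R] (S : Submonoid R) (M : Type) [AddCommGroup M] [Module R M] :
    Prop :=
  MemC R S M

/-- `ω` is the value obtained from an exact sequence `0 → N → P₁ → ⋯ → Pₙ → M → 0`
(`n ≥ 0`), with all terms satisfying `Mem`, each `Pᵢ ∈ 𝓟`, via the formula
`ω = (∏ i, 𝓕(Pᵢ)^((-1)^i)) · 𝓕(N)`; inverses are recorded by witnesses `u`. -/
def PosShiftValue (R : Type) [Ring R] (S : Submonoid R) {Ω : Type} [CommMonoid Ω]
    (Mem : (M : Type) → [AddCommGroup M] → [Module R M] → Prop)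
    (F : (M : Type) → [AddCommGroup M] → [Module R M] → Ω) (n : ℕ)
    (M : Type) [AddCommGroup M] [Module R M] (ω : Ω) : Prop :=
  ∃ D : ModSeq R, D.ExactTrunc n ∧ Nonempty (D.C (n+1) ≃ₗ[R] M) ∧
    (∀ i, i ≤ n+1 → Mem (D.C i)) ∧ (∀ i, 1 ≤ i → i ≤ n → MemP R S (D.C i)) ∧
    ∃ u : ℕ → Ω, (∀ i, 1 ≤ i → i ≤ n → F (D.C i) * u i = 1) ∧
      ω = (∏ i ∈ Finset.range n, if (i+1) % 2 = 1 then u (i+1) else F (D.C (i+1))) * F (D.C 0)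

/-- `ω` is the value obtained from an exact sequence `0 → M → P_m → ⋯ → P₁ → N → 0`
(`m ≥ 1` corresponding to the shift `n = -m < 0`) via the formula
`ω = (∏ i, 𝓕(Pᵢ)^((-1)^i)) · 𝓕(N)`. -/
def NegShiftValue (R : Type) [Ring R] (S : Submonoid R) {Ω : Type} [CommMonoid Ω]
    (Mem : (M : Type) → [AddCommGroup M] → [Module R M] → Prop)
    (F : (M : Type) → [AddCommGroup M] → [Module R M] → Ω) (m : ℕ)
    (M : Type) [AddCommGroup M] [Module R M] (ω : Ω) : Prop :=
  ∃ D : ModSeq R, D.ExactTrunc m ∧ Nonempty (D.C 0 ≃ₗ[R] M) ∧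
    (∀ i, i ≤ m+1 → Mem (D.C i)) ∧ (∀ i, 1 ≤ i → i ≤ m → MemP R S (D.C i)) ∧
    ∃ u : ℕ → Ω, (∀ i, 1 ≤ i → i ≤ m → F (D.C i) * u i = 1) ∧
      ω = (∏ i ∈ Finset.range m, if (i+1) % 2 = 1 then u (m-i) else F (D.C (m-i))) * F (D.C (m+1))

/-- `ω` is the value of the `n`-th shift (`n ∈ ℤ`) of `F` at `M` computed from some
admissible exact sequence whose terms satisfy `Mem`. -/
def ShiftValue (R : Type) [Ring R] (S : Submonoid R) {Ω : Type} [CommMonoid Ω]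
    (Mem : (M : Type) → [AddCommGroup M] → [Module R M] → Prop)
    (F : (M : Type) → [AddCommGroup M] → [Module R M] → Ω) (n : ℤ)
    (M : Type) [AddCommGroup M] [Module R M] (ω : Ω) : Prop :=
  if 0 ≤ n then PosShiftValue R S Mem F n.toNat M ω else NegShiftValue R S Mem F (-n).toNat M ω

/-- The axioms for the family of shifts `{𝓕⁽ⁿ⁾ : 𝓜 → Ω}` of a quasi-Fitting invariant. -/
def IsShiftFamily (R : Type) [Ring R] (S : Submonoid R) {Ω : Type} [CommMonoid Ω]
    (F : (M : Type) → [AddCommGroup M] → [Module R M] → Ω)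
    (G : ℤ → (M : Type) → [AddCommGroup M] → [Module R M] → Ω) : Prop :=
  (∀ (M : Type) [AddCommGroup M] [Module R M], MemC R S M → G 0 M = F M) ∧
  (∀ (n : ℤ) (P : Type) [AddCommGroup P] [Module R P], MemQ R S P → IsUnit (G n P)) ∧
  (∀ (n : ℤ) (N P M : Type) [AddCommGroup N] [Module R N] [AddCommGroup P] [Module R P]
      [AddCommGroup M] [Module R M], MemM R S N → MemQ R S P → MemM R S M →
    ∀ (ι : N →ₗ[R] P) (p : P →ₗ[R] M), Function.Injective ι → Function.Surjective p →
      Function.Exact ι p → G n M = G n P * G (n-1) N) ∧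
  (∀ (n : ℤ) (M' M P : Type) [AddCommGroup M'] [Module R M'] [AddCommGroup M] [Module R M]
      [AddCommGroup P] [Module R P], MemM R S M' → MemM R S M → MemQ R S P →
    ∀ (ι : M' →ₗ[R] M) (p : M →ₗ[R] P), Function.Injective ι → Function.Surjective p →
      Function.Exact ι p → G n M = G n P * G n M') ∧
  (∀ (n : ℤ) (P M M' : Type) [AddCommGroup P] [Module R P] [AddCommGroup M] [Module R M]
      [AddCommGroup M'] [Module R M'], MemQ R S P → MemM R S M → MemM R S M' →
    ∀ (ι : P →ₗ[R] M) (p : M →ₗ[R] M'), Function.Injective ι → Function.Surjective p →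
      Function.Exact ι p → G n M = G n P * G n M')

end

theorem Submodule.exists_smul_mem_span_range_of_projective {R : Type*} [CommRing R]
    [IsNoetherianRing R] {a : ℕ} (K : Submodule R (Fin a → R)) [Module.Projective R K]
    (p : Ideal R) [p.IsPrime] :
    ∃ k : Fin a → K, ∃ t ∉ p, ∀ x : K, t • x ∈ Submodule.span R (Set.range k) := by
  classical
  have : Nontrivial R := nontrivial_of_ne 1 0 fun h ↦ p.one_notMem (h ▸ p.zero_mem)
  let Kp := LocalizedModule p.primeCompl K
  let Rp := Localization.AtPrime p
  have : Module.Flat Rp Kp := inferInstance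
  have : Module.Finite Rp Kp := inferInstance
  have : Module.Free Rp Kp :=
    Module.free_of_flat_of_isLocalRing (P := LocalizedModule p.primeCompl K)
  have hr : Module.finrank Rp Kp ≤ a := by
    have h1 := LinearMap.finrank_le_finrank_of_injective
      (LocalizedModule.map_injective p.primeCompl K.subtype K.subtype_injective)
    have h2 := congrFun (Module.rankAtStalk_eq_finrank_of_free (R := R) (M := Fin a → R)) ⟨p, ‹_›⟩
    refine h1.trans (le_of_eq (h2.trans ?_))
    simp
  let b := Module.finBasis Rp Kp
  have hb : ∀ i, ∃ (x : K) (s : p.primeCompl), LocalizedModule.mk x s = b i := fun i ↦ by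
    induction h : b i using LocalizedModule.induction_on with
    | _ x s => exact ⟨x, s, rfl⟩
  choose x s hxs using hb
  let k : Fin a → K := fun i ↦ if h : i.1 < Module.finrank Rp Kp then x ⟨i, h⟩ else 0
  have hxk : ∀ i, x i ∈ Submodule.span R (Set.range k) := fun i ↦
    Submodule.subset_span ⟨⟨i, i.2.trans_le hr⟩, by simp [k]⟩
  set N := Submodule.span R (Set.range k)
  have hN : N.localized p.primeCompl = ⊤ := by
    rw [eq_top_iff, ← b.span_eq, Submodule.span_le]
    rintro _ ⟨i, rfl⟩
    refine ⟨x i, hxk i, s i, ?_⟩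
    rw [← hxs, IsLocalizedModule.mk_eq_mk']
  have hloc : ∀ y : K, ∃ t ∈ p.primeCompl, t • y ∈ N := fun y ↦ by
    have hy : LocalizedModule.mkLinearMap p.primeCompl K y ∈ N.localized p.primeCompl :=
      hN ▸ trivial
    obtain ⟨m, hm, u, hu⟩ := hy
    rw [IsLocalizedModule.mk'_eq_iff, ← LinearMap.map_smul_of_tower,
      IsLocalizedModule.eq_iff_exists p.primeCompl] at hu
    obtain ⟨c, hc⟩ := hu
    refine ⟨c * u, (c * u).2, ?_⟩
    rw [mul_smul]
    change c • u • y ∈ N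
    rw [← hc]
    exact N.smul_of_tower_mem c hm
  obtain ⟨G, hG⟩ := (Module.Finite.fg_top : (⊤ : Submodule R K).FG)
  choose t ht htN using hloc
  refine ⟨k, ∏ g ∈ G, t g, ?_, fun y ↦ ?_⟩
  · exact Submonoid.prod_mem p.primeCompl fun g _ ↦ ht g
  · have hy : y ∈ Submodule.span R (G : Set K) := hG ▸ trivial
    induction hy using Submodule.span_induction with
    | mem g hg =>
      rw [← Finset.prod_erase_mul _ _ hg, mul_smul]
      exact N.smul_mem _ (htN g)
    | zero => simp
    | add u v _ _ hu hv => rw [smul_add]; exact N.add_mem hu hv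
    | smul c u _ hu => rw [smul_comm]; exact N.smul_mem c hu

section FittingIdeal

variable {R : Type} [CommRing R]

theorem det_mem_fittingIdeal {M : Type} [AddCommGroup M] [Module R M] {ι : Type} [Fintype ι]
    [DecidableEq ι] (m : ι → M) (hm : Submodule.span R (Set.range m) = ⊤) (A : Matrix ι ι R)
    (hA : ∀ j, ∑ i, A i j • m i = 0) : A.det ∈ fittingIdeal R M := by
  let e := Fintype.equivFin ι
  refine Ideal.subset_span ⟨Fintype.card ι, A.submatrix e.symm e.symm,
    Fintype.linearCombination R (m ∘ e.symm), ?_, fun j ↦ ?_, ?_⟩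
  · rw [← LinearMap.range_eq_top, Fintype.range_linearCombination, ← hm]
    congr 1
    exact e.symm.surjective.range_comp m
  · rw [Fintype.linearCombination_apply, ← hA (e.symm j), ← e.symm.sum_comp]
    rfl
  · exact (Matrix.det_submatrix_equiv_self e.symm A).symm

theorem fittingIdeal_le {M : Type} [AddCommGroup M] [Module R M] {I : Ideal R}
    (h : ∀ (a : ℕ) (m : Fin a → M) (A : Matrix (Fin a) (Fin a) R),
      Submodule.span R (Set.range m) = ⊤ → (∀ j, ∑ i, A i j • m i = 0) → A.det ∈ I) :
    fittingIdeal R M ≤ I := by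
  refine Ideal.span_le.2 ?_
  rintro _ ⟨a, A, π, hπ, hA, rfl⟩
  have hπ' : π = Fintype.linearCombination R (fun i ↦ π (Pi.single i 1)) := by
    ext i
    simp
  refine h a (fun i ↦ π (Pi.single i 1)) A ?_ fun j ↦ ?_
  · rw [← Fintype.range_linearCombination, ← hπ', LinearMap.range_eq_top.2 hπ]
  · rw [← hA j, ← Fintype.linearCombination_apply, ← hπ']

theorem fittingIdeal_congr {M N : Type} [AddCommGroup M] [Module R M] [AddCommGroup N] [Module R N]
    (e : M ≃ₗ[R] N) : fittingIdeal R M = fittingIdeal R N := by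
  have key : ∀ {M N : Type} [AddCommGroup M] [Module R M] [AddCommGroup N] [Module R N]
      (e : M ≃ₗ[R] N), fittingIdeal R M ≤ fittingIdeal R N := by
    intro M N _ _ _ _ e
    refine fittingIdeal_le fun a m A hm hA ↦ det_mem_fittingIdeal (e ∘ m) ?_ A fun j ↦ ?_
    · rw [Set.range_comp, ← LinearEquiv.coe_coe, ← Submodule.map_span, hm, Submodule.map_top,
        LinearEquiv.range]
    · simpa using congrArg e (hA j)
  exact le_antisymm (key e) (key e.symm)

theorem Ideal.mem_of_forall_maximal {I : Ideal R} {x : R}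
    (h : ∀ p : Ideal R, p.IsMaximal → ∃ t ∉ p, t * x ∈ I) : x ∈ I := by
  by_contra hx
  have hne : Submodule.comap (LinearMap.toSpanSingleton R R x) I ≠ ⊤ := fun h1 ↦ hx <| by
    have : (1 : R) ∈ Submodule.comap (LinearMap.toSpanSingleton R R x) I := h1 ▸ trivial
    simpa using this
  obtain ⟨p, hp, hle⟩ := Ideal.exists_le_maximal _ hne
  obtain ⟨t, ht, htx⟩ := h p hp
  exact ht (hle (by simpa using htx))

variable {M' M P : Type} [AddCommGroup M'] [Module R M'] [AddCommGroup M] [Module R M]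
  [AddCommGroup P] [Module R P] {ι : M' →ₗ[R] M} {π : M →ₗ[R] P}

theorem fittingIdeal_mul_le (hπ : Function.Surjective π) (hex : Function.Exact ι π) :
    fittingIdeal R P * fittingIdeal R M' ≤ fittingIdeal R M := by
  refine Ideal.mul_le.2 fun r hr s hs ↦ ?_
  suffices fittingIdeal R M' ≤
      Submodule.comap (LinearMap.toSpanSingleton R R r) (fittingIdeal R M) by
    simpa [mul_comm] using this hs
  refine fittingIdeal_le fun b w B hw hB ↦ ?_
  suffices fittingIdeal R P ≤
      Submodule.comap (LinearMap.toSpanSingleton R R B.det) (fittingIdeal R M) by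
    simpa [mul_comm] using this hr
  refine fittingIdeal_le fun a p A hp hA ↦ ?_
  choose m hm using fun i ↦ hπ (p i)
  have hker : ∀ j, ∃ c : Fin b → R, ι (∑ i, c i • w i) = ∑ i, A i j • m i := fun j ↦ by
    obtain ⟨z, hz⟩ := (hex (∑ i, A i j • m i)).1 (by simp [hm, hA])
    obtain ⟨c, hc⟩ := (Submodule.mem_span_range_iff_exists_fun R).1
      (hw ▸ Submodule.mem_top (x := z))
    exact ⟨c, by rw [hc, hz]⟩
  choose c hc using hker
  have hdet := det_mem_fittingIdeal (Sum.elim m (ι ∘ w)) ?_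
    (Matrix.fromBlocks A 0 (Matrix.of fun i j ↦ -c j i) B) ?_
  · simpa [Matrix.det_fromBlocks_zero₁₂] using hdet
  · rw [Set.Sum.elim_range, Submodule.span_union, Set.range_comp, ← Submodule.map_span, hw,
      Submodule.map_top, eq_top_iff]
    intro x _
    obtain ⟨e, he⟩ := (Submodule.mem_span_range_iff_exists_fun R).1
      (hp ▸ Submodule.mem_top (x := π x))
    obtain ⟨z, hz⟩ := (hex (x - ∑ i, e i • m i)).1 (by simp [hm, he])
    rw [← add_sub_cancel (∑ i, e i • m i) x, ← hz]
    exact Submodule.add_mem_sup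
      ((Submodule.mem_span_range_iff_exists_fun R).2 ⟨e, rfl⟩) ⟨z, rfl⟩
  · rintro (j | j)
    · simp [← hc]
    · simpa using congrArg ι (hB j)

theorem fittingIdeal_le_mul [IsNoetherianRing R]
    (hP : ∀ (a : ℕ) (f : (Fin a → R) →ₗ[R] P), Function.Surjective f →
      Module.Projective R (LinearMap.ker f))
    (hM' : Module.Finite R M') (hι : Function.Injective ι) (hπ : Function.Surjective π)
    (hex : Function.Exact ι π) :
    fittingIdeal R M ≤ fittingIdeal R P * fittingIdeal R M' := by
  refine fittingIdeal_le fun a m A hm hA ↦ Ideal.mem_of_forall_maximal fun p hp ↦ ?_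
  let f := Fintype.linearCombination R m
  have hf : Function.Surjective f := by
    rw [← LinearMap.range_eq_top, Fintype.range_linearCombination, hm]
  have := hP a (π ∘ₗ f) (hπ.comp hf)
  obtain ⟨k, t, ht, hk⟩ :=
    Submodule.exists_smul_mem_span_range_of_projective (LinearMap.ker (π ∘ₗ f)) p
  have hk' : ∀ y : LinearMap.ker (π ∘ₗ f), ∃ c : Fin a → R, ∑ i, c i • k i = t • y := fun y ↦
    Submodule.mem_span_range_iff_exists_fun R |>.1 (hk y)
  have hg : ∀ y : LinearMap.ker (π ∘ₗ f), ∃ z : M', ι z = f y := fun y ↦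
    (hex (f y)).1 y.2
  choose g hg using hg
  have hAker : ∀ j, (fun i ↦ A i j) ∈ LinearMap.ker (π ∘ₗ f) := fun j ↦ by
    have : f (fun i ↦ A i j) = 0 := by rw [← hA j]; rfl
    simp [this]
  choose c hc using fun j ↦ hk' ⟨_, hAker j⟩
  obtain ⟨b, w, hw⟩ := Module.Finite.exists_fin (R := R) (M := M')
  have hl : ∀ j, ∃ y : LinearMap.ker (π ∘ₗ f), f y = ι (w j) := fun j ↦ by
    obtain ⟨y, hy⟩ := hf (ι (w j))
    exact ⟨⟨y, by simp [hy, hex.apply_apply_eq_zero]⟩, hy⟩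
  choose y hy using hl
  choose d hd using fun j ↦ hk' (y j)
  let B : Matrix (Fin a) (Fin a) R := Matrix.of fun i j ↦ (k j : Fin a → R) i
  let C : Matrix (Fin a) (Fin a) R := Matrix.of fun i j ↦ c j i
  have hBC : t • A = B * C := by
    ext i j
    have := congrFun (congrArg Subtype.val (hc j)) i
    simp only [Submodule.coe_sum, Submodule.coe_smul, Finset.sum_apply, Pi.smul_apply,
      smul_eq_mul] at this
    simp [B, C, Matrix.mul_apply, ← this, mul_comm]
  let E : Matrix (Fin a ⊕ Fin b) (Fin a ⊕ Fin b) R :=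
    Matrix.fromBlocks C (Matrix.of fun i j ↦ -d j i) 0 (t • 1)
  have hE : E.det = C.det * t ^ b := by
    simp [E, Matrix.det_fromBlocks_zero₂₁]
  have hB : B.det ∈ fittingIdeal R P := by
    refine det_mem_fittingIdeal (π ∘ m) ?_ B fun j ↦ ?_
    · rw [Set.range_comp, ← Submodule.map_span, hm, Submodule.map_top, LinearMap.range_eq_top.2 hπ]
    · have := LinearMap.mem_ker.1 (k j).2
      rw [LinearMap.comp_apply, Fintype.linearCombination_apply, map_sum] at this
      simp only [map_smul] at this
      exact this
  have hEmem : E.det ∈ fittingIdeal R M' := by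
    refine det_mem_fittingIdeal (Sum.elim (fun i ↦ g (k i)) w) ?_ E fun j ↦ hι ?_
    · rw [eq_top_iff, ← hw]
      exact Submodule.span_mono (by rintro _ ⟨i, rfl⟩; exact ⟨Sum.inr i, rfl⟩)
    · have hsum : ∀ c : Fin a → R, ∑ i, c i • ι (g (k i)) = f ↑(∑ i, c i • k i) := fun c ↦ by
        simp [hg]
      rcases j with j | j
      · simp [E, C, hsum, hc, f, Fintype.linearCombination_apply, hA]
      · simp [E, hsum, hd, hy, Matrix.one_apply]
  refine ⟨t ^ (a + b), fun h ↦ ht (hp.isPrime.mem_of_pow_mem _ h), ?_⟩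
  have hfin : t ^ (a + b) * A.det = B.det * E.det := by
    have := congrArg Matrix.det hBC
    rw [Matrix.det_smul, Matrix.det_mul, Fintype.card_fin] at this
    rw [hE, ← mul_assoc, ← this]
    ring
  rw [hfin]
  exact Ideal.mul_mem_mul hB hEmem

end FittingIdeal

section ProjectiveDimension

variable {R : Type} [CommRing R]

theorem hasProjectiveDimensionLT_two_of_pdLE {P : Type} [AddCommGroup P] [Module R P]
    (h : PdLE R 1 P) : HasProjectiveDimensionLT (ModuleCat.of R P) 2 := by
  obtain ⟨k, f, hf, hK⟩ := h
  have hK : Module.Projective R (LinearMap.ker f) := hK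
  rw [IsProjective.iff_projective, projective_iff_hasProjectiveDimensionLT_one] at hK
  exact (LinearMap.shortExact_shortComplexKer hf).hasProjectiveDimensionLT_X₃ 1 hK inferInstance

theorem projective_ker_of_hasProjectiveDimensionLT_two {P : Type} [AddCommGroup P] [Module R P]
    (h : HasProjectiveDimensionLT (ModuleCat.of R P) 2) {a : ℕ} {f : (Fin a → R) →ₗ[R] P}
    (hf : Function.Surjective f) : Module.Projective R (LinearMap.ker f) := by
  rw [IsProjective.iff_projective, projective_iff_hasProjectiveDimensionLT_one]
  exact (LinearMap.shortExact_shortComplexKer hf).hasProjectiveDimensionLT_X₁ 1 inferInstance h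

theorem hasProjectiveDimensionLT_two_quotient_span {s : R} (hs : s ∈ nonZeroDivisors R) :
    HasProjectiveDimensionLT (ModuleCat.of R (R ⧸ Ideal.span {s})) 2 := by
  have hex : Function.Exact (LinearMap.mulLeft R s) (Ideal.span {s}).mkQ := fun x ↦ by
    rw [Submodule.mkQ_apply, Submodule.Quotient.mk_eq_zero, Ideal.mem_span_singleton']
    simp [mul_comm, eq_comm]
  refine (ModuleCat.shortComplex_shortExact (ModuleCat.shortComplexOfCompEqZero
    (LinearMap.mulLeft R s) (Ideal.span {s}).mkQ hex.linearMap_comp_eq_zero) hex ?_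
    (Submodule.mkQ_surjective _)).hasProjectiveDimensionLT_X₃ 1
    (inferInstanceAs (HasProjectiveDimensionLT (ModuleCat.of R R) 1))
    (inferInstanceAs (HasProjectiveDimensionLT (ModuleCat.of R R) 2))
  exact fun x y hxy ↦ (mul_cancel_left_mem_nonZeroDivisors hs).1 hxy

end ProjectiveDimension

section FittFrac

variable {R : Type} [CommRing R] {S : Submonoid R}

theorem STorsion.of_injective {M N : Type} [AddCommGroup M] [Module R M] [AddCommGroup N]
    [Module R N] (h : STorsion R S N) {f : M →ₗ[R] N} (hf : Function.Injective f) :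
    STorsion R S M := fun m ↦ by
  obtain ⟨s, hs, hsm⟩ := h (f m)
  exact ⟨s, hs, hf (by rw [map_smul, hsm, map_zero])⟩

theorem STorsion.prod {M N : Type} [AddCommGroup M] [Module R M] [AddCommGroup N]
    [Module R N] (hM : STorsion R S M) (hN : STorsion R S N) : STorsion R S (M × N) :=
  fun ⟨m, n⟩ ↦ by
  obtain ⟨s, hs, hsm⟩ := hM m
  obtain ⟨t, ht, htn⟩ := hN n
  exact ⟨s * t, S.mul_mem hs ht, by
    ext
    · simp [mul_comm s, mul_smul, hsm]
    · simp [mul_smul, htn]⟩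

theorem STorsion.exists_smul_eq_zero {M : Type} [AddCommGroup M] [Module R M]
    (h : STorsion R S M) [Module.Finite R M] : ∃ s ∈ S, ∀ m : M, s • m = 0 := by
  classical
  obtain ⟨G, hG⟩ := (Module.Finite.fg_top : (⊤ : Submodule R M).FG)
  choose t ht htm using h
  refine ⟨∏ g ∈ G, t g, S.prod_mem fun g _ ↦ ht g, fun m ↦ ?_⟩
  have hm : m ∈ Submodule.span R (G : Set M) := hG ▸ trivial
  induction hm using Submodule.span_induction with
  | mem g hg => rw [← Finset.prod_erase_mul _ _ hg, mul_smul, htm, smul_zero]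
  | zero => simp
  | add u v _ _ hu hv => rw [smul_add, hu, hv, add_zero]
  | smul c u _ hu => rw [smul_comm, hu, smul_zero]

theorem fittFrac_congr {M N : Type} [AddCommGroup M] [Module R M] [AddCommGroup N] [Module R N]
    (e : M ≃ₗ[R] N) : fittFrac R S M = fittFrac R S N := by
  rw [fittFrac, fittFrac, fittingIdeal_congr e]

theorem fittFrac_eq_mul [IsNoetherianRing R] {M' M P : Type} [AddCommGroup M'] [Module R M']
    [AddCommGroup M] [Module R M] [AddCommGroup P] [Module R P] [Module.Finite R M']
    (hP : HasProjectiveDimensionLT (ModuleCat.of R P) 2) {ι : M' →ₗ[R] M} {π : M →ₗ[R] P}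
    (hι : Function.Injective ι) (hπ : Function.Surjective π) (hex : Function.Exact ι π) :
    fittFrac R S M = fittFrac R S P * fittFrac R S M' := by
  have h : fittingIdeal R M = fittingIdeal R P * fittingIdeal R M' :=
    le_antisymm (fittingIdeal_le_mul
      (fun _ _ hf ↦ projective_ker_of_hasProjectiveDimensionLT_two hP hf) ‹_› hι hπ hex)
      (fittingIdeal_mul_le hπ hex)
  rw [fittFrac, h]
  exact IsLocalization.coeSubmodule_mul (Localization S) _ _

theorem fittingIdeal_quotient_span (s : R) :
    fittingIdeal R (R ⧸ Ideal.span {s}) = Ideal.span {s} := by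
  refine le_antisymm (fittingIdeal_le fun a m A hm hA ↦ ?_) ?_
  · have hdet : ∀ i, A.det • m i = 0 := fun i ↦ by
      calc A.det • m i = ∑ l, (A * A.adjugate) l i • m l := by
            simp [Matrix.mul_adjugate, Matrix.one_apply]
        _ = ∑ j, A.adjugate j i • ∑ l, A l j • m l := by
            simp_rw [Matrix.mul_apply, Finset.sum_smul, Finset.smul_sum, smul_smul]
            rw [Finset.sum_comm]
            simp_rw [mul_comm]
        _ = 0 := by simp [hA]
    obtain ⟨e, he⟩ := (Submodule.mem_span_range_iff_exists_fun R).1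
      (hm ▸ Submodule.mem_top (x := (Submodule.Quotient.mk 1 : R ⧸ Ideal.span {s})))
    have h1 : A.det • (Submodule.Quotient.mk 1 : R ⧸ Ideal.span {s}) = 0 := by
      rw [← he, Finset.smul_sum]
      exact Finset.sum_eq_zero fun i _ ↦ by rw [smul_comm, hdet, smul_zero]
    rwa [← Submodule.Quotient.mk_smul, Submodule.Quotient.mk_eq_zero, smul_eq_mul, mul_one] at h1
  · rw [Ideal.span_singleton_le_iff_mem]
    have := det_mem_fittingIdeal (fun _ : Unit ↦ (Submodule.Quotient.mk 1 : R ⧸ Ideal.span {s})) ?_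
      (Matrix.of fun _ _ ↦ s) ?_
    · simpa using this
    · rw [eq_top_iff]
      intro x _
      obtain ⟨x, rfl⟩ := Submodule.Quotient.mk_surjective _ x
      refine (Submodule.mem_span_range_iff_exists_fun R).2 ⟨fun _ ↦ x, ?_⟩
      rw [Fintype.sum_unique, ← Submodule.Quotient.mk_smul, smul_eq_mul, mul_one]
    · intro
      simp only [Finset.univ_unique, Matrix.of_apply, Finset.sum_const, Finset.card_singleton,
        one_smul]
      rw [← Submodule.Quotient.mk_smul, Submodule.Quotient.mk_eq_zero]
      simp

theorem isUnit_fittFrac_quotient_span {s : R} (hs : s ∈ S) :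
    IsUnit (fittFrac R S (R ⧸ Ideal.span {s})) := by
  have h : fittFrac R S (R ⧸ Ideal.span {s})
      = Submodule.span R {algebraMap R (Localization S) s} := by
    rw [fittFrac, fittingIdeal_quotient_span]
    exact IsLocalization.coeSubmodule_span_singleton _ s
  refine IsUnit.of_mul_eq_one (Submodule.span R {Localization.mk 1 ⟨s, hs⟩}) ?_
  rw [h, Submodule.span_mul_span, Set.singleton_mul_singleton, Submodule.one_eq_span,
    ← Localization.mk_one_eq_algebraMap, Localization.mk_mul]
  congr 2
  simp

variable (R S) in
/-- Finitely generated `S`-torsion modules of projective dimension at most one whose Fitting ideal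
is invertible. -/
structure IsAdmissible (P : Type) [AddCommGroup P] [Module R P] : Prop where
  finite : Module.Finite R P
  torsion : STorsion R S P
  pd : HasProjectiveDimensionLT (ModuleCat.of R P) 2
  isUnit : IsUnit (fittFrac R S P)

theorem isAdmissible_pi_quotient_span [IsNoetherianRing R] (hS : S ≤ nonZeroDivisors R) {s : R}
    (hs : s ∈ S) (k : ℕ) : IsAdmissible R S (Fin k → R ⧸ Ideal.span {s}) := by
  have htors : STorsion R S (Fin k → R ⧸ Ideal.span {s}) := fun m ↦ ⟨s, hs, by
    ext i
    obtain ⟨x, hx⟩ := Submodule.Quotient.mk_surjective _ (m i)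
    rw [Pi.smul_apply, ← hx, ← Submodule.Quotient.mk_smul]
    exact (Submodule.Quotient.mk_eq_zero _).2
      (Ideal.mul_mem_right _ _ (Ideal.mem_span_singleton_self s))⟩
  suffices HasProjectiveDimensionLT (ModuleCat.of R (Fin k → R ⧸ Ideal.span {s})) 2 ∧
      IsUnit (fittFrac R S (Fin k → R ⧸ Ideal.span {s})) from
    ⟨inferInstance, htors, this.1, this.2⟩
  clear htors
  induction k with
  | zero =>
    refine ⟨?_, ?_⟩
    · have : HasProjectiveDimensionLT (ModuleCat.of R (Fin 0 → R ⧸ Ideal.span {s})) 0 :=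
        (ModuleCat.isZero_of_subsingleton _).hasProjectiveDimensionLT_zero
      exact hasProjectiveDimensionLT_of_ge _ 0 2 (by lia)
    · have h : fittingIdeal R (Fin 0 → R ⧸ Ideal.span {s}) = ⊤ := by
        rw [Ideal.eq_top_iff_one]
        simpa using det_mem_fittingIdeal (M := Fin 0 → R ⧸ Ideal.span {s}) (ι := Empty)
          Empty.elim (Subsingleton.elim _ _) 0 (fun j ↦ j.elim)
      have h1 : fittFrac R S (Fin 0 → R ⧸ Ideal.span {s}) = 1 := by
        rw [fittFrac, h]
        exact IsLocalization.coeSubmodule_top _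
      rw [h1]
      exact isUnit_one
  | succ k ih =>
    let A := R ⧸ Ideal.span {s}
    let ι : (Fin k → A) →ₗ[R] (Fin (k + 1) → A) :=
      LinearMap.pi (Fin.cons 0 fun i ↦ LinearMap.proj i)
    let π : (Fin (k + 1) → A) →ₗ[R] A := LinearMap.proj 0
    have hι : Function.Injective ι := fun x y hxy ↦ by
      ext i
      exact congrFun hxy i.succ
    have hπ : Function.Surjective π := fun x ↦ ⟨fun _ ↦ x, rfl⟩
    have hex : Function.Exact ι π := fun x ↦ by
      refine ⟨fun hx ↦ ⟨fun i ↦ x i.succ, ?_⟩, ?_⟩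
      · ext i
        refine Fin.cases ?_ (fun i ↦ ?_) i
        · exact Eq.symm hx
        · rfl
      · rintro ⟨y, rfl⟩
        rfl
    have hA := hasProjectiveDimensionLT_two_quotient_span (hS hs)
    refine ⟨?_, ?_⟩
    · exact (ModuleCat.shortComplex_shortExact (ModuleCat.shortComplexOfCompEqZero ι π
        hex.linearMap_comp_eq_zero) hex hι hπ).hasProjectiveDimensionLT_X₂ 2 ih.1 hA
    · rw [fittFrac_eq_mul hA hι hπ hex]
      exact (isUnit_fittFrac_quotient_span hs).mul ih.2

theorem exists_isAdmissible_surjective [IsNoetherianRing R] (hS : S ≤ nonZeroDivisors R)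
    {M : Type} [AddCommGroup M] [Module R M] [Module.Finite R M] (hM : STorsion R S M) :
    ∃ (Q : Type) (_ : AddCommGroup Q) (_ : Module R Q) (q : Q →ₗ[R] M),
      IsAdmissible R S Q ∧ Function.Surjective q := by
  obtain ⟨s, hs, hsM⟩ := hM.exists_smul_eq_zero
  obtain ⟨k, w, hw⟩ := Module.Finite.exists_fin (R := R) (M := M)
  let l : Fin k → (R ⧸ Ideal.span {s}) →ₗ[R] M := fun i ↦
    Submodule.liftQ _ (LinearMap.toSpanSingleton R M (w i)) <| by
      rw [Ideal.span_singleton_le_iff_mem]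
      simp [hsM]
  refine ⟨_, _, _, ∑ i, l i ∘ₗ LinearMap.proj i, isAdmissible_pi_quotient_span hS hs k,
    fun x ↦ ?_⟩
  obtain ⟨c, hc⟩ := (Submodule.mem_span_range_iff_exists_fun R).1 (hw ▸ Submodule.mem_top (x := x))
  refine ⟨fun i ↦ Submodule.Quotient.mk (c i), ?_⟩
  rw [← hc, LinearMap.sum_apply]
  rfl

theorem IsAdmissible.ker [IsNoetherianRing R] {Q P : Type} [AddCommGroup Q] [Module R Q]
    [AddCommGroup P] [Module R P] (hQ : IsAdmissible R S Q) (hP : IsAdmissible R S P)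
    {f : Q →ₗ[R] P} (hf : Function.Surjective f) : IsAdmissible R S (LinearMap.ker f) := by
  have := hQ.finite
  refine ⟨inferInstance, hQ.torsion.of_injective (LinearMap.ker f).subtype_injective, ?_, ?_⟩
  · have := hP.pd
    exact (LinearMap.shortExact_shortComplexKer hf).hasProjectiveDimensionLT_X₁ 2 hQ.pd
      (hasProjectiveDimensionLT_of_ge (ModuleCat.of R P) 2 3 (by lia))
  · have h := hQ.isUnit
    rw [fittFrac_eq_mul hP.pd (LinearMap.ker f).subtype_injective hf
      (LinearMap.exact_subtype_ker_map f)] at h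
    exact isUnit_of_mul_isUnit_right h

end FittFrac

section Shift

variable {R : Type} [CommRing R]

/-- The left term of a short exact sequence is isomorphic to the kernel of the right map. -/
noncomputable def LinearEquiv.ofExactKer {K X P : Type} [AddCommGroup K] [Module R K]
    [AddCommGroup X] [Module R X] [AddCommGroup P] [Module R P] {ι : K →ₗ[R] X} {p : X →ₗ[R] P}
    (hι : Function.Injective ι) (hex : Function.Exact ι p) : K ≃ₗ[R] LinearMap.ker p :=
  (LinearEquiv.ofInjective ι hι).trans (LinearEquiv.ofEq _ _ hex.linearMap_ker_eq.symm)

variable (R) in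
/-- `ShiftVal R S n M ω` : the fractional ideal `ω` is the value of the `n`-th shift of the Fitting
ideal at `M` computed from some resolution of length `n` by admissible modules. -/
def ShiftVal (S : Submonoid R) : ℕ → (M : Type) → [AddCommGroup M] → [Module R M] →
    Submodule R (Localization S) → Prop
  | 0, M, _, _, ω => ω = fittFrac R S M
  | n + 1, M, _, _, ω => ∃ (P : Type) (_ : AddCommGroup P) (_ : Module R P) (π : P →ₗ[R] M)
      (u : (Submodule R (Localization S))ˣ) (ω' : Submodule R (Localization S)),
      IsAdmissible R S P ∧ Function.Surjective π ∧ (u : Submodule R (Localization S)) =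
        fittFrac R S P ∧ ShiftVal S n (LinearMap.ker π) ω' ∧
      ω = ω' * ((u ^ ((-1 : ℤ) ^ (n + 1)) : (Submodule R (Localization S))ˣ) :
        Submodule R (Localization S))

variable {S : Submonoid R}

theorem ShiftVal.congr {n : ℕ} {M N : Type} [AddCommGroup M] [Module R M] [AddCommGroup N]
    [Module R N] {ω : Submodule R (Localization S)} (h : ShiftVal R S n M ω) (e : M ≃ₗ[R] N) :
    ShiftVal R S n N ω := by
  induction n generalizing M N ω with
  | zero => exact Eq.trans h (fittFrac_congr e)
  | succ n ih =>
    obtain ⟨P, _, _, π, u, ω', hP, hπ, hu, hω', rfl⟩ := h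
    exact ⟨P, _, _, e.toLinearMap ∘ₗ π, u, ω', hP, e.surjective.comp hπ, hu,
      ih hω' (LinearEquiv.ofEq _ _ (LinearEquiv.ker_comp e π).symm), rfl⟩

variable [IsNoetherianRing R]

theorem exists_shiftVal (hS : S ≤ nonZeroDivisors R) (n : ℕ) {M : Type} [AddCommGroup M]
    [Module R M] [Module.Finite R M] (hM : STorsion R S M) : ∃ ω, ShiftVal R S n M ω := by
  induction n generalizing M with
  | zero => exact ⟨_, rfl⟩
  | succ n ih =>
    obtain ⟨Q, _, _, q, hQ, hq⟩ := exists_isAdmissible_surjective hS hM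
    have := hQ.finite
    obtain ⟨ω, hω⟩ := ih (hQ.torsion.of_injective (LinearMap.ker q).subtype_injective)
    exact ⟨_, Q, _, _, q, hQ.isUnit.unit, ω, hQ, hq, rfl, hω, rfl⟩

theorem ShiftVal.mul_of_surjective (hS : S ≤ nonZeroDivisors R) {n : ℕ} {X P : Type}
    [AddCommGroup X] [Module R X] [AddCommGroup P] [Module R P] [Module.Finite R X]
    (hX : STorsion R S X) (hP : IsAdmissible R S P) {p : X →ₗ[R] P} (hp : Function.Surjective p)
    (huniq : ∀ ω ω', ShiftVal R S n (LinearMap.ker p) ω → ShiftVal R S n (LinearMap.ker p) ω' →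
      ω = ω') {ω : Submodule R (Localization S)} (h : ShiftVal R S n (LinearMap.ker p) ω)
    {u : (Submodule R (Localization S))ˣ} (hu : (u : Submodule R (Localization S)) =
      fittFrac R S P) :
    ShiftVal R S n X (ω * ((u ^ ((-1 : ℤ) ^ n) : (Submodule R (Localization S))ˣ) :
      Submodule R (Localization S))) := by
  cases n with
  | zero =>
    have h : ω = _ := h
    have h2 := fittFrac_eq_mul (S := S) hP.pd (LinearMap.ker p).subtype_injective hp
      (LinearMap.exact_subtype_ker_map p)
    change _ = fittFrac R S X
    rw [h2, h, ← hu, pow_zero, zpow_one, mul_comm]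
  | succ n =>
    obtain ⟨Q, _, _, q, hQ, hq⟩ := exists_isAdmissible_surjective hS hX
    have := hQ.finite
    have hpq : Function.Surjective (p ∘ₗ q) := hp.comp hq
    have hQ' := hQ.ker hP hpq
    obtain ⟨ωL, hL⟩ := exists_shiftVal hS n
      (hQ.torsion.of_injective (LinearMap.ker q).subtype_injective)
    let r : LinearMap.ker (p ∘ₗ q) →ₗ[R] LinearMap.ker p :=
      q.restrict fun x hx ↦ hx
    have hr : Function.Surjective r := fun ⟨x, hx⟩ ↦ by
      obtain ⟨y, rfl⟩ := hq x
      exact ⟨⟨y, hx⟩, rfl⟩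
    let j : LinearMap.ker q →ₗ[R] LinearMap.ker (p ∘ₗ q) :=
      Submodule.inclusion (LinearMap.ker_le_ker_comp q p)
    have hj : Function.Exact j r := fun x ↦ by
      refine ⟨fun hx ↦ ⟨⟨x, congrArg Subtype.val hx⟩, rfl⟩, ?_⟩
      rintro ⟨y, rfl⟩
      exact Subtype.ext y.2
    have eL := LinearEquiv.ofExactKer (Submodule.inclusion_injective _) hj
    have hK := huniq _ _ h ⟨_, _, _, r, hQ'.isUnit.unit, ωL, hQ', hr, rfl, hL.congr eL, rfl⟩
    have hmul : hQ.isUnit.unit = u * hQ'.isUnit.unit := by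
      ext1
      rw [Units.val_mul, hu]
      exact fittFrac_eq_mul hP.pd (LinearMap.ker (p ∘ₗ q)).subtype_injective hpq
        (LinearMap.exact_subtype_ker_map _)
    refine ⟨Q, _, _, q, hQ.isUnit.unit, ωL, hQ, hq, rfl, hL, ?_⟩
    have hz := mul_zpow u hQ'.isUnit.unit ((-1 : ℤ) ^ (n + 1))
    rw [hK, hmul, hz, Units.val_mul, mul_assoc, mul_comm (Units.val _) (Units.val _)]

theorem ShiftVal.unique (hS : S ≤ nonZeroDivisors R) {n : ℕ} {M : Type} [AddCommGroup M]
    [Module R M] {ω ω' : Submodule R (Localization S)} (h : ShiftVal R S n M ω)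
    (h' : ShiftVal R S n M ω') : ω = ω' := by
  induction n generalizing M ω ω' with
  | zero => exact Eq.trans h (Eq.symm h')
  | succ n ih =>
    obtain ⟨P, _, _, π, u, ν, hP, hπ, hu, hν, rfl⟩ := h
    obtain ⟨P', _, _, π', u', ν', hP', hπ', hu', hν', rfl⟩ := h'
    have := hP.finite
    have := hP'.finite
    let X := LinearMap.ker (π.coprod (-π'))
    have hXmem : ∀ x : P × P', x ∈ X ↔ π x.1 = π' x.2 := fun x ↦ by
      simp [X, LinearMap.coprod_apply, ← sub_eq_add_neg, sub_eq_zero]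
    have hX : STorsion R S X := (hP.torsion.prod hP'.torsion).of_injective X.subtype_injective
    let p : X →ₗ[R] P := LinearMap.fst R P P' ∘ₗ X.subtype
    let p' : X →ₗ[R] P' := LinearMap.snd R P P' ∘ₗ X.subtype
    have hp : Function.Surjective p := fun x ↦ by
      obtain ⟨y, hy⟩ := hπ' (π x)
      exact ⟨⟨(x, y), (hXmem _).2 hy.symm⟩, rfl⟩
    have hp' : Function.Surjective p' := fun y ↦ by
      obtain ⟨x, hx⟩ := hπ (π' y)
      exact ⟨⟨(x, y), (hXmem _).2 hx⟩, rfl⟩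
    let i : LinearMap.ker π →ₗ[R] X :=
      (LinearMap.inl R P P' ∘ₗ (LinearMap.ker π).subtype).codRestrict X fun x ↦
        (hXmem _).2 (by simp)
    let i' : LinearMap.ker π' →ₗ[R] X :=
      (LinearMap.inr R P P' ∘ₗ (LinearMap.ker π').subtype).codRestrict X fun x ↦
        (hXmem _).2 (by simp)
    have hi : Function.Injective i := fun x y hxy ↦
      Subtype.ext (congrArg (fun z : X ↦ z.1.1) hxy)
    have hi' : Function.Injective i' := fun x y hxy ↦
      Subtype.ext (congrArg (fun z : X ↦ z.1.2) hxy)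
    have hex : Function.Exact i p' := fun x ↦ by
      refine ⟨fun (hx : x.1.2 = 0) ↦ ⟨⟨x.1.1, ?_⟩, ?_⟩, ?_⟩
      · rw [LinearMap.mem_ker, (hXmem x).1 x.2, hx, map_zero]
      · exact Subtype.ext (Prod.ext rfl hx.symm)
      · rintro ⟨y, rfl⟩
        rfl
    have hex' : Function.Exact i' p := fun x ↦ by
      refine ⟨fun (hx : x.1.1 = 0) ↦ ⟨⟨x.1.2, ?_⟩, ?_⟩, ?_⟩
      · rw [LinearMap.mem_ker, ← (hXmem x).1 x.2, hx, map_zero]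
      · exact Subtype.ext (Prod.ext hx.symm rfl)
      · rintro ⟨y, rfl⟩
        rfl
    have key := ih
      ((hν.congr (.ofExactKer hi hex)).mul_of_surjective hS hX hP' hp' (fun _ _ ↦ ih) hu')
      ((hν'.congr (.ofExactKer hi' hex')).mul_of_surjective hS hX hP hp (fun _ _ ↦ ih) hu)
    rw [pow_succ, mul_neg_one, zpow_neg, zpow_neg, Units.mul_inv_eq_iff_eq_mul, mul_right_comm,
      Units.eq_mul_inv_iff_mul_eq, key]

end Shift

section ModSeq

variable {R : Type} [CommRing R]

/-- The range of the map arriving in the `i`-th term, with no map arriving in the `0`-th one. -/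
def ModSeq.prevRange (D : ModSeq R) : (i : ℕ) → Submodule R (D.C i)
  | 0 => ⊥
  | i + 1 => LinearMap.range (D.f i)

theorem ModSeq.ExactTrunc.ker_eq {D : ModSeq R} {n : ℕ} (hD : D.ExactTrunc n) {i : ℕ}
    (hi : i ≤ n) : LinearMap.ker (D.f i) = D.prevRange i := by
  cases i with
  | zero => exact LinearMap.ker_eq_bot.2 hD.1
  | succ i => exact (hD.2.2 i hi).linearMap_ker_eq

theorem ModSeq.shiftVal {S : Submonoid R} (D : ModSeq R) (J : ℕ → Submodule R (Localization S))
    (n : ℕ) (hker : ∀ i < n, LinearMap.ker (D.f i) = D.prevRange i)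
    (hP : ∀ i, 1 ≤ i → i ≤ n → MemP R S (D.C i))
    (hJ : ∀ i, 1 ≤ i → i ≤ n → fittFrac R S (D.C i) * J i = 1)
    {M : Type} [AddCommGroup M] [Module R M] (g : D.C n →ₗ[R] M) (hg : Function.Surjective g)
    (hgker : LinearMap.ker g = D.prevRange n) :
    ShiftVal R S n M
      ((∏ i ∈ Finset.range n, if (i+1) % 2 = 1 then J (i+1) else fittFrac R S (D.C (i+1)))
        * fittFrac R S (D.C 0)) := by
  induction n generalizing M with
  | zero =>
    rw [Finset.prod_range_zero, one_mul]
    exact fittFrac_congr (.ofBijective g ⟨LinearMap.ker_eq_bot.1 hgker, hg⟩)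
  | succ n ih =>
    have hPn := hP (n + 1) (by lia) le_rfl
    have hJn := hJ (n + 1) (by lia) le_rfl
    have hmem : ∀ x, D.f n x ∈ LinearMap.ker g := fun x ↦ hgker ▸ ⟨x, rfl⟩
    have := ih (fun i hi ↦ hker i (by lia)) (fun i h1 hi ↦ hP i h1 (by lia))
      (fun i h1 hi ↦ hJ i h1 (by lia)) ((D.f n).codRestrict (LinearMap.ker g) hmem)
      (fun ⟨y, hy⟩ ↦ by
        rw [hgker] at hy
        obtain ⟨x, rfl⟩ := hy
        exact ⟨x, rfl⟩)
      (by rw [LinearMap.ker_codRestrict, hker n (by lia)])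
    refine ⟨D.C (n + 1), _, _, g, .mkOfMulEqOne _ _ hJn, _, ⟨hPn.1.1, hPn.1.2,
      hasProjectiveDimensionLT_two_of_pdLE hPn.2, .of_mul_eq_one _ hJn⟩, hg, rfl, this, ?_⟩
    rw [Finset.prod_range_succ, mul_right_comm]
    congr 1
    rcases Nat.even_or_odd (n + 1) with h | h
    · rw [h.neg_one_pow, zpow_one, if_neg (by rw [Nat.even_iff.1 h]; lia)]
      rfl
    · rw [h.neg_one_pow, zpow_neg_one, if_pos (Nat.odd_iff.1 h)]
      rfl

end ModSeq

/-- Independence of the fractional ideal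
`𝓕^[n](M) = (∏ i, Fitt(Pᵢ)^((-1)^i)) · Fitt(N)` from the chosen resolution
`0 → N → P₁ → ⋯ → Pₙ → M → 0` by finitely generated `S`-torsion modules with
`pd_R(Pᵢ) ≤ 1`.  The sequences are encoded by `ModSeq`s `D`, `D'`, with
`D.C 0 = N`, `D.C i = Pᵢ` (`1 ≤ i ≤ n`) and `D.C (n+1) ≅ M`; the `J i` are the
inverses of the invertible fractional ideals `Fitt(Pᵢ)`. -/
theorem statement0
    (R : Type) [CommRing R] [IsNoetherianRing R] (S : Submonoid R)
    (hS : S ≤ nonZeroDivisors R)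
    (M : Type) [AddCommGroup M] [Module R M]
    (hMfg : Module.Finite R M) (hMtors : STorsion R S M) (n : ℕ)
    (D D' : ModSeq R)
    (hD : D.ExactTrunc n) (hD' : D'.ExactTrunc n)
    (eD : D.C (n+1) ≃ₗ[R] M) (eD' : D'.C (n+1) ≃ₗ[R] M)
    (hmem : ∀ i, i ≤ n+1 → MemM R S (D.C i))
    (hmem' : ∀ i, i ≤ n+1 → MemM R S (D'.C i))
    (hP : ∀ i, 1 ≤ i → i ≤ n → PdLE R 1 (D.C i))
    (hP' : ∀ i, 1 ≤ i → i ≤ n → PdLE R 1 (D'.C i))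
    (J J' : ℕ → Submodule R (Localization S))
    (hJ : ∀ i, 1 ≤ i → i ≤ n → fittFrac R S (D.C i) * J i = 1)
    (hJ' : ∀ i, 1 ≤ i → i ≤ n → fittFrac R S (D'.C i) * J' i = 1) :
    (∏ i ∈ Finset.range n, if (i+1) % 2 = 1 then J (i+1) else fittFrac R S (D.C (i+1)))
        * fittFrac R S (D.C 0)
      = (∏ i ∈ Finset.range n, if (i+1) % 2 = 1 then J' (i+1) else fittFrac R S (D'.C (i+1)))
        * fittFrac R S (D'.C 0) := by
  have h := D.shiftVal J n (fun i hi ↦ hD.ker_eq hi.le)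
    (fun i h1 hi ↦ ⟨hmem i (by lia), hP i h1 hi⟩) hJ (D.f n) hD.2.1 (hD.ker_eq le_rfl)
  have h' := D'.shiftVal J' n (fun i hi ↦ hD'.ker_eq hi.le)
    (fun i h1 hi ↦ ⟨hmem' i (by lia), hP' i h1 hi⟩) hJ' (D'.f n) hD'.2.1 (hD'.ker_eq le_rfl)
  exact (h.congr eD).unique hS (h'.congr eD')
end

section
/- Let R be a commutative noetherian ring and S a multiplicative subset of R consisting of non-zero-divisors. (i) If P is a finitely generated S-torsion R-module with pd_R(P) ≤ 1, then Fitt_R(P) is an invertible fractional ideal of R with respect to S, i.e., there is a finitely generated R-submodule J of S^{-1}R with Fitt_R(P)·J = R. (ii) If 0 → M' → M → P → 0 is an exact sequence of finitely generated S-torsion R-modules with pd_R(P) ≤ 1, then Fitt_R(M) = Fitt_R(P)·Fitt_R(M'). In other words, M ↦ Fitt_R(M) is a Fitting invariant valued in the monoid Ω of finitely generated R-submodules of S^{-1}R. -/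
open CategoryTheory MulOpposite

section MinorIdeal

variable {R : Type*} [CommRing R] {ι κ : Type*} [Fintype ι] [DecidableEq ι] [Fintype κ]
  [DecidableEq κ]

/-- The ideal generated by the determinants of the square matrices with all rows in `K`. -/
def minorIdeal (K : Submodule R (ι → R)) : Ideal R :=
  Ideal.span {x | ∃ A : Matrix ι ι R, (∀ i, A i ∈ K) ∧ A.det = x}

theorem det_mem_minorIdeal {K : Submodule R (ι → R)} {A : Matrix ι ι R} (hA : ∀ i, A i ∈ K) :
    A.det ∈ minorIdeal K :=
  Ideal.subset_span ⟨A, hA, rfl⟩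

theorem minorIdeal_le {K : Submodule R (ι → R)} {I : Ideal R}
    (h : ∀ A : Matrix ι ι R, (∀ i, A i ∈ K) → A.det ∈ I) : minorIdeal K ≤ I :=
  Ideal.span_le.2 fun _ ⟨A, hA, hx⟩ => hx ▸ h A hA

theorem minorIdeal_top : minorIdeal (⊤ : Submodule R (ι → R)) = ⊤ :=
  (Ideal.eq_top_iff_one _).2 <| by
    simpa using det_mem_minorIdeal (K := (⊤ : Submodule R (ι → R))) (A := 1) fun _ => trivial

theorem minorIdeal_le_of_reindex {K : Submodule R (ι → R)} {L : Submodule R (κ → R)} (e : κ ≃ ι)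
    (h : ∀ v ∈ K, v ∘ e ∈ L) : minorIdeal K ≤ minorIdeal L :=
  minorIdeal_le fun A hA => by
    rw [← Matrix.det_submatrix_equiv_self e A]
    exact det_mem_minorIdeal fun i => h _ (hA (e i))

/-- Vectors related by a shear after multiplication by a non-zero-divisor have the same
determinants. -/
theorem minorIdeal_le_of_shear {K L : Submodule R (ι ⊕ κ → R)} {s : R}
    (hs : s ∈ nonZeroDivisors R) (H : (κ → R) →ₗ[R] (ι → R))
    (h : ∀ v ∈ K, ∃ w ∈ L, w ∘ Sum.inr = v ∘ Sum.inr ∧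
      s • (v ∘ Sum.inl) + H (v ∘ Sum.inr) = s • (w ∘ Sum.inl)) :
    minorIdeal K ≤ minorIdeal L := by
  refine minorIdeal_le fun A hA => ?_
  choose B hB hr hl using fun i => h (A i) (hA i)
  have key : A * Matrix.fromBlocks (s • 1) 0 (LinearMap.toMatrix' H).transpose 1 =
      Matrix.of B * Matrix.fromBlocks (s • 1) 0 0 1 := by
    ext i (j | j)
    · have h₁ := congrFun (hl i) j
      rw [← LinearMap.toMatrix'_mulVec] at h₁
      simp only [Pi.add_apply, Pi.smul_apply, Function.comp_apply, smul_eq_mul, Matrix.mulVec,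
        dotProduct] at h₁
      simp only [Matrix.mul_apply, Fintype.sum_sum_type, Matrix.fromBlocks_apply₁₁,
        Matrix.fromBlocks_apply₂₁, Matrix.smul_apply, Matrix.one_apply, smul_eq_mul, mul_ite,
        mul_one, mul_zero, Finset.sum_ite_eq', Finset.mem_univ, if_true,
        Matrix.transpose_apply, Matrix.zero_apply, Finset.sum_const_zero, add_zero,
        Matrix.of_apply]
      rw [mul_comm, mul_comm (B i _), ← h₁]
      simp only [mul_comm]
    · have h₁ := congrFun (hr i) j
      simp only [Function.comp_apply] at h₁
      simp [Matrix.mul_apply, Matrix.one_apply, h₁]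
  have hdet := congrArg Matrix.det key
  simp only [Matrix.det_mul, Matrix.det_fromBlocks_zero₁₂, Matrix.det_smul, Matrix.det_one,
    mul_one] at hdet
  rw [(mul_cancel_right_mem_nonZeroDivisors (pow_mem hs _)).1 hdet]
  exact det_mem_minorIdeal hB

/-- The submodule `K × L` of `R^(ι ⊕ κ)`. -/
def sumProd (K : Submodule R (ι → R)) (L : Submodule R (κ → R)) : Submodule R (ι ⊕ κ → R) :=
  K.comap (LinearMap.funLeft R R Sum.inl) ⊓ L.comap (LinearMap.funLeft R R Sum.inr)

omit [Fintype ι] [DecidableEq ι] [Fintype κ] [DecidableEq κ] in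
theorem mem_sumProd {K : Submodule R (ι → R)} {L : Submodule R (κ → R)} {v : ι ⊕ κ → R} :
    v ∈ sumProd K L ↔ v ∘ Sum.inl ∈ K ∧ v ∘ Sum.inr ∈ L :=
  Iff.rfl

theorem minorIdeal_sumProd (K : Submodule R (ι → R)) (L : Submodule R (κ → R)) :
    minorIdeal (sumProd K L) = minorIdeal K * minorIdeal L := by
  apply le_antisymm
  · refine minorIdeal_le fun A hA => ?_
    set m : ι ⊕ κ → ι ⊕ κ → R := fun i => Sum.elim (A i ∘ Sum.inl) 0 with hm
    set m' : ι ⊕ κ → ι ⊕ κ → R := fun i => Sum.elim 0 (A i ∘ Sum.inr) with hm'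
    have hA' : A = m + m' := by
      ext i (j | j) <;> simp [hm, hm']
    have : A.det = ∑ s : Finset (ι ⊕ κ), (Matrix.of (s.piecewise m m')).det := by
      rw [hA']
      exact Matrix.detRowAlternating.map_add_univ m m'
    rw [this]
    refine Ideal.sum_mem _ fun s _ => ?_
    set B : Matrix (ι ⊕ κ) (ι ⊕ κ) R := Matrix.of (s.piecewise m m') with hB
    by_cases hσ : ∃ σ : Equiv.Perm (ι ⊕ κ), ∀ i, σ i ∈ s ↔ i.isLeft
    · obtain ⟨σ, hσ⟩ := hσ
      have hl : ∀ i, σ (Sum.inl i) ∈ s := fun i => (hσ _).2 rfl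
      have hr : ∀ i, σ (Sum.inr i) ∉ s := fun i hi => by simpa using (hσ _).1 hi
      have hblock : B.submatrix σ id = Matrix.fromBlocks
          (Matrix.of fun i => A (σ (Sum.inl i)) ∘ Sum.inl) 0 0
          (Matrix.of fun i => A (σ (Sum.inr i)) ∘ Sum.inr) := by
        ext (i | i) (j | j) <;> simp [hB, hl, hr, hm, hm', Finset.piecewise]
      have hdet := Matrix.det_permute σ B
      rw [hblock, Matrix.det_fromBlocks_zero₁₂] at hdet
      have hmem : (Equiv.Perm.sign σ : R) * B.det ∈ minorIdeal K * minorIdeal L := by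
        rw [← hdet]
        exact Ideal.mul_mem_mul (det_mem_minorIdeal fun i => (hA _).1)
          (det_mem_minorIdeal fun i => (hA _).2)
      have hunit : IsUnit ((Equiv.Perm.sign σ : ℤ) : R) :=
        (Units.isUnit (Equiv.Perm.sign σ)).map (Int.castRingHom R)
      exact (Ideal.unit_mul_mem_iff_mem _ hunit).1 hmem
    · push Not at hσ
      have : B.det = 0 := by
        rw [Matrix.det_apply]
        refine Finset.sum_eq_zero fun σ _ => ?_
        obtain ⟨i, hi⟩ := hσ σ
        have h0 : B (σ i) i = 0 := by
          rcases i with i | i <;> simp at hi <;> simp [hB, hi, hm, hm', Finset.piecewise]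
        have hprod : ∏ j, B (σ j) j = 0 := Finset.prod_eq_zero (Finset.mem_univ i) h0
        exact (congrArg (Equiv.Perm.sign σ • ·) hprod).trans (smul_zero (Equiv.Perm.sign σ))
      rw [this]
      exact Ideal.zero_mem _
  · rw [minorIdeal, minorIdeal, Ideal.span_mul_span', Ideal.span_le]
    rintro _ ⟨_, ⟨X, hX, rfl⟩, _, ⟨Y, hY, rfl⟩, rfl⟩
    change X.det * Y.det ∈ _
    rw [← Matrix.det_fromBlocks_zero₁₂ X 0 Y]
    refine det_mem_minorIdeal ?_
    rintro (i | i)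
    · exact ⟨hX i, L.zero_mem⟩
    · exact ⟨K.zero_mem, hY i⟩

variable {M : Type*} [AddCommGroup M] [Module R M]

/-- The map `R^(ι ⊕ κ) → M` induced by maps `R^ι → M` and `R^κ → M`. -/
def sumMap (f : (ι → R) →ₗ[R] M) (g : (κ → R) →ₗ[R] M) : (ι ⊕ κ → R) →ₗ[R] M :=
  f ∘ₗ LinearMap.funLeft R R Sum.inl + g ∘ₗ LinearMap.funLeft R R Sum.inr

omit [Fintype ι] [DecidableEq ι] [Fintype κ] [DecidableEq κ] in
theorem sumMap_apply (f : (ι → R) →ₗ[R] M) (g : (κ → R) →ₗ[R] M) (v : ι ⊕ κ → R) :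
    sumMap f g v = f (v ∘ Sum.inl) + g (v ∘ Sum.inr) :=
  rfl

theorem minorIdeal_ker_sumMap {f : (ι → R) →ₗ[R] M} (hf : Function.Surjective f)
    (g : (κ → R) →ₗ[R] M) :
    minorIdeal (LinearMap.ker (sumMap f g)) = minorIdeal (LinearMap.ker f) := by
  obtain ⟨H, hH⟩ := Module.projective_lifting_property f g hf
  have hH' : ∀ x, f (H x) = g x := LinearMap.congr_fun hH
  trans minorIdeal (sumProd (LinearMap.ker f) (⊤ : Submodule R (κ → R)))
  · apply le_antisymm
    · refine minorIdeal_le_of_shear (one_mem _) H fun v hv =>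
        ⟨Sum.elim (v ∘ Sum.inl + H (v ∘ Sum.inr)) (v ∘ Sum.inr), ⟨?_, trivial⟩, ?_, ?_⟩
      · change f (v ∘ Sum.inl + H (v ∘ Sum.inr)) = 0
        rw [map_add, hH']
        exact hv
      · simp
      · simp
    · refine minorIdeal_le_of_shear (one_mem _) (-H) fun v hv =>
        ⟨Sum.elim (v ∘ Sum.inl - H (v ∘ Sum.inr)) (v ∘ Sum.inr), ?_, ?_, ?_⟩
      · have h0 : f (v ∘ Sum.inl) = 0 := hv.1
        simp [sumMap_apply, hH', h0]
      · simp
      · simp [sub_eq_add_neg]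
  · rw [minorIdeal_sumProd, minorIdeal_top, Ideal.mul_top]

/-- The ideal of maximal minors does not depend on the presentation. -/
theorem minorIdeal_ker_le {f : (ι → R) →ₗ[R] M} (hf : Function.Surjective f)
    {g : (κ → R) →ₗ[R] M} (hg : Function.Surjective g) :
    minorIdeal (LinearMap.ker f) ≤ minorIdeal (LinearMap.ker g) := by
  rw [← minorIdeal_ker_sumMap hf g, ← minorIdeal_ker_sumMap hg f]
  refine minorIdeal_le_of_reindex (Equiv.sumComm κ ι) fun v hv => ?_
  rw [LinearMap.mem_ker, sumMap_apply] at hv ⊢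
  rw [← hv, add_comm]
  rfl

end MinorIdeal

section Fitting

variable {R : Type} [CommRing R] {M : Type} [AddCommGroup M] [Module R M]

theorem fittingIdeal_eq_minorIdeal {ι : Type*} [Fintype ι] [DecidableEq ι]
    {f : (ι → R) →ₗ[R] M} (hf : Function.Surjective f) :
    fittingIdeal R M = minorIdeal (LinearMap.ker f) := by
  apply le_antisymm
  · refine Ideal.span_le.2 ?_
    rintro _ ⟨a, A, π, hπ, hA, rfl⟩
    rw [← Matrix.det_transpose]
    exact minorIdeal_ker_le hπ hf (det_mem_minorIdeal hA)
  · set e := Fintype.equivFin ι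
    have hg : Function.Surjective (f ∘ₗ (LinearEquiv.funCongrLeft R R e).toLinearMap) :=
      hf.comp (LinearEquiv.funCongrLeft R R e).surjective
    refine (minorIdeal_ker_le hf hg).trans (minorIdeal_le fun A hA => Ideal.subset_span ?_)
    exact ⟨_, A.transpose, _, hg, hA, A.det_transpose.symm⟩

theorem exists_mem_forall_smul_mem_ker {S : Submonoid R} (hM : STorsion R S M) {k : ℕ}
    (f : (Fin k → R) →ₗ[R] M) : ∃ s ∈ S, ∀ x, s • x ∈ LinearMap.ker f := by
  choose t ht h using fun i => hM (f (Pi.single i 1))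
  refine ⟨∏ i, t i, prod_mem fun i _ => ht i, fun x => ?_⟩
  suffices h : (∏ i, t i) • f = 0 by
    rw [LinearMap.mem_ker, map_smul]
    exact LinearMap.congr_fun h x
  refine LinearMap.pi_ext' fun i => LinearMap.ext_ring ?_
  have : (∏ i, t i) • f (Pi.single i 1) = 0 := by
    rw [← Finset.prod_erase_mul _ _ (Finset.mem_univ i), mul_smul, h, smul_zero]
  simpa using this

theorem fittingIdeal_eq_mul {S : Submonoid R} (hS : S ≤ nonZeroDivisors R)
    {M' P : Type} [AddCommGroup M'] [Module R M'] [AddCommGroup P] [Module R P]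
    [Module.Finite R M'] (hP : STorsion R S P) (hpd : PdLE R 1 P)
    {i : M' →ₗ[R] M} {p : M →ₗ[R] P} (hi : Function.Injective i) (hp : Function.Surjective p)
    (hex : Function.Exact i p) :
    fittingIdeal R M = fittingIdeal R P * fittingIdeal R M' := by
  obtain ⟨k, f, hf, hproj⟩ := hpd
  have : Module.Projective R (LinearMap.ker f) := hproj
  obtain ⟨l, f', hf'⟩ := Module.Finite.exists_fin' R M'
  obtain ⟨g, hg⟩ := Module.projective_lifting_property p f hp
  have hg' : ∀ x, p (g x) = f x := LinearMap.congr_fun hg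
  obtain ⟨s, hsS, hs⟩ := exists_mem_forall_smul_mem_ker hP f
  have hif' : Function.Exact (i ∘ₗ f') p := fun x => by
    rw [hex x]
    exact ⟨fun ⟨y, hy⟩ => (hf' y).elim fun z hz => ⟨z, by simp [hz, hy]⟩,
      fun ⟨z, hz⟩ => ⟨f' z, hz⟩⟩
  let q : (Fin l → R) →ₗ[R] LinearMap.ker p :=
    (i ∘ₗ f').codRestrict _ fun x => (hif' _).2 ⟨x, rfl⟩
  have hq : Function.Surjective q := fun ⟨x, hx⟩ =>
    ((hif' x).1 hx).elim fun z hz => ⟨z, Subtype.ext hz⟩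
  let r : LinearMap.ker f →ₗ[R] LinearMap.ker p :=
    (g ∘ₗ (LinearMap.ker f).subtype).codRestrict _ fun x => by
      simp [hg']
  obtain ⟨h, hh⟩ := Module.projective_lifting_property q r hq
  have hh' : ∀ x : LinearMap.ker f, i (f' (h x)) = g x := fun x =>
    congrArg Subtype.val (LinearMap.congr_fun hh x)
  let H : (Fin k → R) →ₗ[R] (Fin l → R) := h ∘ₗ (s • LinearMap.id).codRestrict _ hs
  have hH : ∀ x : LinearMap.ker f, H x = s • h x := fun x => by
    rw [← map_smul]
    rfl
  have hsurj : Function.Surjective (sumMap (i ∘ₗ f') g) := fun x => by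
    obtain ⟨y, hy⟩ := hf (p x)
    obtain ⟨z, hz⟩ := (hif' (x - g y)).1 (by rw [map_sub, hg', hy, sub_self])
    exact ⟨Sum.elim z y, by simp only [sumMap_apply, Sum.elim_comp_inl, Sum.elim_comp_inr, hz,
      sub_add_cancel]⟩
  rw [fittingIdeal_eq_minorIdeal hsurj, fittingIdeal_eq_minorIdeal hf,
    fittingIdeal_eq_minorIdeal hf', mul_comm, ← minorIdeal_sumProd]
  apply le_antisymm
  · refine minorIdeal_le_of_shear (hS hsS) H fun v hv => ?_
    have hv' : i (f' (v ∘ Sum.inl)) + g (v ∘ Sum.inr) = 0 := hv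
    have hmem : v ∘ Sum.inr ∈ LinearMap.ker f := by
      have := congrArg p hv'
      rwa [map_add, hex.apply_apply_eq_zero, zero_add, map_zero, hg'] at this
    refine ⟨Sum.elim (v ∘ Sum.inl + h ⟨_, hmem⟩) (v ∘ Sum.inr), ⟨?_, hmem⟩, rfl, ?_⟩
    · refine hi ?_
      change i (f' (v ∘ Sum.inl + h ⟨_, hmem⟩)) = i 0
      rw [map_add, map_add, hh', hv', map_zero]
    · rw [Sum.elim_comp_inl, smul_add, ← hH]
  · refine minorIdeal_le_of_shear (hS hsS) (-H) fun v hv => ?_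
    obtain ⟨hv', hmem⟩ := mem_sumProd.1 hv
    refine ⟨Sum.elim (v ∘ Sum.inl - h ⟨_, hmem⟩) (v ∘ Sum.inr), ?_, rfl, ?_⟩
    · rw [LinearMap.mem_ker, sumMap_apply, Sum.elim_comp_inl, Sum.elim_comp_inr,
        LinearMap.comp_apply, map_sub, LinearMap.mem_ker.1 hv', zero_sub, map_neg, hh',
        neg_add_cancel]
    · rw [Sum.elim_comp_inl, smul_sub, ← hH, LinearMap.neg_apply, sub_eq_add_neg]

theorem fittFrac_eq_mul_s2 {S : Submonoid R} {M₁ M₂ : Type} [AddCommGroup M₁] [Module R M₁]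
    [AddCommGroup M₂] [Module R M₂]
    (h : fittingIdeal R M = fittingIdeal R M₁ * fittingIdeal R M₂) :
    fittFrac R S M = fittFrac R S M₁ * fittFrac R S M₂ := by
  rw [fittFrac, h]
  exact IsLocalization.coeSubmodule_mul _ _ _

theorem minorIdeal_range_smul (k : ℕ) (s : R) :
    minorIdeal (LinearMap.range (s • LinearMap.id : (Fin k → R) →ₗ[R] Fin k → R)) =
      Ideal.span {s ^ k} := by
  apply le_antisymm
  · refine minorIdeal_le fun A hA => ?_
    choose B hB using hA
    have : A = s • Matrix.of B := by
      ext i j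
      rw [← hB]
      rfl
    rw [this, Matrix.det_smul, Fintype.card_fin]
    exact Ideal.mul_mem_right _ _ (Ideal.mem_span_singleton_self _)
  · rw [Ideal.span_singleton_le_iff_mem]
    have : (s • (1 : Matrix (Fin k) (Fin k) R)).det = s ^ k := by simp
    rw [← this]
    exact det_mem_minorIdeal fun i => ⟨(1 : Matrix (Fin k) (Fin k) R) i, rfl⟩

theorem exists_fittFrac_mul_eq_one [IsNoetherianRing R] {S : Submonoid R}
    (hS : S ≤ nonZeroDivisors R) (hM : STorsion R S M) (hpd : PdLE R 1 M) :
    ∃ J : Submodule R (Localization S), J.FG ∧ fittFrac R S M * J = 1 := by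
  obtain ⟨k, f, hf, -⟩ := id hpd
  obtain ⟨s, hsS, hs⟩ := exists_mem_forall_smul_mem_ker hM f
  set Q := LinearMap.range (s • LinearMap.id : (Fin k → R) →ₗ[R] Fin k → R)
  have hQ : Q ≤ LinearMap.ker f := by
    rintro _ ⟨x, rfl⟩
    exact hs x
  set N := (LinearMap.ker f).map Q.mkQ with hN
  have hfit : fittingIdeal R ((Fin k → R) ⧸ Q) = fittingIdeal R M * fittingIdeal R N := by
    refine fittingIdeal_eq_mul hS hM hpd (i := N.subtype) (p := Q.liftQ f hQ)
      N.injective_subtype ?_ ?_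
    · exact LinearMap.range_eq_top.1 (by rw [Submodule.range_liftQ, LinearMap.range_eq_top.2 hf])
    · rw [LinearMap.exact_iff, Submodule.range_subtype, Submodule.ker_liftQ]
  have hspan : fittingIdeal R ((Fin k → R) ⧸ Q) = Ideal.span {s ^ k} := by
    rw [fittingIdeal_eq_minorIdeal Q.mkQ_surjective, Submodule.ker_mkQ, minorIdeal_range_smul]
  refine ⟨fittFrac R S N *
    Submodule.span R {IsLocalization.mk' (Localization S) (1 : R) ⟨s ^ k, pow_mem hsS k⟩}, ?_, ?_⟩
  · exact ((IsNoetherian.noetherian _).map _).mul (Submodule.fg_span_singleton _)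
  · rw [← mul_assoc, ← fittFrac_eq_mul_s2 hfit, fittFrac, hspan]
    change IsLocalization.coeSubmodule (Localization S) _ * _ = _
    rw [IsLocalization.coeSubmodule_span_singleton, Submodule.span_mul_span,
      Set.singleton_mul_singleton, IsLocalization.mk'_spec'_mk, map_one, Submodule.one_eq_span]

end Fitting

/-- Over a commutative noetherian ring `R` with a multiplicative set `S`
of non-zero-divisors, `M ↦ Fitt_R(M)` is a Fitting invariant valued in the monoid of
finitely generated `R`-submodules of `S⁻¹R`:
(i) `Fitt_R(P)` is an invertible fractional ideal for `P` finitely generated `S`-torsion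
with `pd_R(P) ≤ 1`;
(ii) `Fitt_R(M) = Fitt_R(P) · Fitt_R(M')` for every exact sequence `0 → M' → M → P → 0`
of finitely generated `S`-torsion modules with `pd_R(P) ≤ 1` (both as ideals of `R` and
as fractional ideals). -/
theorem statement2
    (R : Type) [CommRing R] [IsNoetherianRing R] (S : Submonoid R)
    (hS : S ≤ nonZeroDivisors R) :
    (∀ (P : Type) [AddCommGroup P] [Module R P], Module.Finite R P → STorsion R S P →
      PdLE R 1 P → ∃ J : Submodule R (Localization S), J.FG ∧ fittFrac R S P * J = 1) ∧
    (∀ (M' M P : Type) [AddCommGroup M'] [Module R M'] [AddCommGroup M] [Module R M]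
        [AddCommGroup P] [Module R P],
      MemM R S M' → MemM R S M → MemM R S P → PdLE R 1 P →
      ∀ (ι : M' →ₗ[R] M) (p : M →ₗ[R] P), Function.Injective ι → Function.Surjective p →
        Function.Exact ι p →
          fittingIdeal R M = fittingIdeal R P * fittingIdeal R M' ∧
          fittFrac R S M = fittFrac R S P * fittFrac R S M') := by
  refine ⟨fun P _ _ _ hP hpd => exists_fittFrac_mul_eq_one hS hP hpd, ?_⟩
  intro M' M P _ _ _ _ _ _ hM' _ hP hpd ι p hι hp hex
  have := hM'.1
  have h := fittingIdeal_eq_mul hS hP.2 hpd hι hp hex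
  exact ⟨h, fittFrac_eq_mul_s2 h⟩
end

section
/- Let R be a left and right noetherian ring and M a nonzero finitely generated left R-module of finite projective dimension d = pd_R(M). Then Ext^d_R(M, R) ≠ 0. Consequently, pd_R(M) = sup{ i : Ext^i_R(M, R) ≠ 0 } for every finitely generated R-module M of finite projective dimension. -/
open CategoryTheory MulOpposite

namespace CategoryTheory

open Limits

universe v u w

/-- The derived-functor groups `Ext^n(X, Y)` and the groups of morphisms in the derived category
vanish simultaneously. -/
lemma subsingleton_leftDerived_ext_iff {C : Type u} [Category.{v} C] [Abelian C]
    [EnoughProjectives C] [HasExt.{w} C] (A : Type*) [Ring A] [Linear A C] (X Y : C) (n : ℕ) :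
    Subsingleton (((_root_.Ext A C n).obj (Opposite.op X)).obj Y) ↔
      Subsingleton (Abelian.Ext X Y n) := by
  let P := projectiveResolution X
  rw [← ModuleCat.isZero_iff_subsingleton, (P.isoExt (R := A) n Y).isZero_iff,
    ← HomologicalComplex.exactAt_iff_isZero_homology]
  cases n with
  | zero =>
    rw [HomologicalComplex.exactAt_iff' _ 0 0 1 (by simp) (by simp),
      ShortComplex.moduleCat_exact_iff, Abelian.Ext.addEquiv₀.subsingleton_congr]
    constructor
    · intro h
      refine subsingleton_of_forall_eq 0 fun f ↦ ?_
      obtain ⟨g, hg⟩ : ∃ g : P.complex.X 0 ⟶ Y, P.complex.d 0 0 ≫ g = P.π.f 0 ≫ f :=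
        h (P.π.f 0 ≫ f) (P.complex_d_comp_π_f_zero_assoc f |>.trans zero_comp)
      rw [P.complex.shape 0 0 (by simp), zero_comp] at hg
      exact (cancel_epi (P.π.f 0)).1 (hg.symm.trans comp_zero.symm)
    · intro h f hf
      have hf₀ : f = 0 := by
        rw [← P.exact₀.g_desc f hf]
        exact (congrArg (P.π.f 0 ≫ ·) (h.elim (P.exact₀.desc f hf) 0)).trans comp_zero
      exact ⟨0, by rw [map_zero, hf₀]⟩
  | succ n =>
    rw [HomologicalComplex.exactAt_iff' _ n (n + 1) (n + 2) (by simp) (by simp),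
      ShortComplex.moduleCat_exact_iff]
    constructor
    · intro h
      refine subsingleton_of_forall_eq 0 fun x ↦ ?_
      obtain ⟨f, hf, rfl⟩ := P.extMk_surjective x (n + 2) rfl
      exact (P.extMk_eq_zero_iff f _ rfl hf n rfl).2 (h f hf)
    · intro h f hf
      exact (P.extMk_eq_zero_iff f _ rfl hf n rfl).1 (Subsingleton.elim _ _)

end CategoryTheory

/-- The dual of a nonzero finitely generated projective module is nonzero. -/
lemma Module.Projective.nontrivial_dual (R M : Type*) [Ring R] [AddCommGroup M] [Module R M]
    [Module.Projective R M] [Nontrivial M] : Nontrivial (M →ₗ[R] R) := by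
  obtain ⟨s, hs⟩ := Module.Projective.out (R := R) (P := M)
  by_contra! h
  obtain ⟨m, hm⟩ := exists_ne (0 : M)
  have : s m = 0 := by
    ext i
    exact LinearMap.congr_fun (Subsingleton.elim ((Finsupp.lapply i).comp s) 0) m
  exact hm (by rw [← hs m, this, map_zero])

/-- A surjection onto `M` with finitely generated projective kernel splits as soon as every
linear form on the kernel extends. -/
lemma LinearMap.exists_section_of_forall_extend {R F M : Type*} [Ring R] [AddCommGroup F]
    [Module R F] [AddCommGroup M] [Module R M] (f : F →ₗ[R] M) (hf : Function.Surjective f)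
    [Module.Finite R (ker f)] [Module.Projective R (ker f)]
    (h : ∀ φ : ker f →ₗ[R] R, ∃ ψ : F →ₗ[R] R, ψ ∘ₗ (ker f).subtype = φ) :
    ∃ g : M →ₗ[R] F, f ∘ₗ g = LinearMap.id := by
  obtain ⟨n, p, s, -, -, hps⟩ := Module.Finite.exists_comp_eq_id_of_projective R (ker f)
  choose t ht using fun i ↦ h (LinearMap.proj i ∘ₗ s)
  have hexact : Function.Exact (ker f).subtype f := LinearMap.exact_subtype_ker_map f
  have hsplit := (hexact.split_tfae' (R := R)).out 0 1
  refine (hsplit.2 ⟨hf, p ∘ₗ LinearMap.pi t, ?_⟩).2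
  rw [LinearMap.comp_assoc, ← hps]
  congr 1
  ext x i
  exact LinearMap.congr_fun (ht i) x

lemma extRVanish_iff (R : Type) [Ring R] (M : Type) [AddCommGroup M] [Module R M] (i : ℕ) :
    ExtRVanish R M i ↔ Subsingleton (Abelian.Ext (ModuleCat.of R M) (ModuleCat.of R R) i) :=
  subsingleton_leftDerived_ext_iff ℤ _ _ i

lemma PdLE.hasProjectiveDimensionLE {R : Type} [Ring R] {d : ℕ} {M : Type} [AddCommGroup M]
    [Module R M] (h : PdLE R d M) : HasProjectiveDimensionLE (ModuleCat.of R M) d := by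
  induction d generalizing M with
  | zero =>
    rw [← projective_iff_hasProjectiveDimensionLE_zero, ← IsProjective.iff_projective]
    exact h
  | succ d ih =>
    obtain ⟨k, f, hf, hK⟩ := h
    exact ((LinearMap.shortExact_shortComplexKer hf).hasProjectiveDimensionLT_X₃_iff d
      ((IsProjective.iff_projective _).1 inferInstance)).2 (ih hK)

lemma PdLE.of_extRVanish {R : Type} [Ring R] [IsNoetherianRing R] {d : ℕ} {M : Type}
    [AddCommGroup M] [Module R M] (h : PdLE R (d + 1) M) (hExt : ExtRVanish R M (d + 1)) :
    PdLE R d M := by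
  rw [extRVanish_iff] at hExt
  induction d generalizing M with
  | zero =>
    obtain ⟨k, f, hf, hK⟩ := h
    have : Module.Projective R (LinearMap.ker f) := hK
    obtain ⟨g, hg⟩ := f.exists_section_of_forall_extend hf fun φ ↦ by
      obtain ⟨x, hx⟩ := Abelian.Ext.contravariant_sequence_exact₁
        (LinearMap.shortExact_shortComplexKer hf) (ModuleCat.of R R)
        (Abelian.Ext.mk₀ (ModuleCat.ofHom φ)) (add_zero 1) (hExt.elim _ _)
      obtain ⟨ψ, rfl⟩ := Abelian.Ext.addEquiv₀.symm.surjective x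
      refine ⟨ψ.hom, ?_⟩
      have := Abelian.Ext.addEquiv₀.symm.injective
        ((Abelian.Ext.mk₀_comp_mk₀ _ _).symm.trans hx)
      exact congrArg ModuleCat.Hom.hom this
    exact Module.Projective.of_split g f hg
  | succ d ih =>
    obtain ⟨k, f, hf, hK⟩ := h
    refine ⟨k, f, hf, ih hK ?_⟩
    refine subsingleton_of_forall_eq 0 fun x ↦ ?_
    have : Projective f.shortComplexKer.X₂ := (IsProjective.iff_projective _).1 inferInstance
    obtain ⟨y, rfl⟩ := Abelian.Ext.contravariant_sequence_exact₁
      (LinearMap.shortExact_shortComplexKer hf) _ x (add_comm 1 (d + 1)) (hExt.elim _ _)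
    rw [y.eq_zero_of_projective, Abelian.Ext.comp_zero]

/-- If `M` is a nonzero finitely generated module of finite projective
dimension `d` over a left and right noetherian ring `R`, then `Ext^d_R(M, R) ≠ 0`;
consequently `pd_R(M) = sup { i : Ext^i_R(M, R) ≠ 0 }`. -/
theorem statement3
    (R : Type) [Ring R] [IsNoetherianRing R] [IsNoetherianRing Rᵐᵒᵖ]
    (M : Type) [AddCommGroup M] [Module R M]
    (hnz : Nontrivial M) (hfg : Module.Finite R M)
    (d : ℕ) (hd : PdLE R d M) (hmin : ∀ k, PdLE R k M → d ≤ k) :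
    ¬ ExtRVanish R M d ∧ ∀ i, ¬ ExtRVanish R M i → i ≤ d := by
  refine ⟨fun hExt ↦ ?_, fun i hi ↦ ?_⟩
  · cases d with
    | zero =>
      have : Module.Projective R M := hd
      rw [extRVanish_iff] at hExt
      have := Module.Projective.nontrivial_dual R M
      refine not_subsingleton (M →ₗ[R] R) ?_
      exact ((ModuleCat.homEquiv (M := ModuleCat.of R M) (N := ModuleCat.of R R)).symm.trans
        Abelian.Ext.addEquiv₀.symm.toEquiv).subsingleton
    | succ d => exact absurd (hmin d (hd.of_extRVanish hExt)) (by lia)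
  · by_contra! hlt
    have := hd.hasProjectiveDimensionLE
    exact hi ((extRVanish_iff R M i).2
      (HasProjectiveDimensionLT.subsingleton _ (d + 1) i hlt _))
end

section
/- Let R be a left and right noetherian ring and S an Ore set of R consisting of non-zero-divisors. Then: (1) for any f ∈ S, there is an isomorphism Ext^1_R(R/Rf, R) ≅ R/fR of right R-modules; (2) if M is a finitely generated S-torsion left R-module, then Ext^1_R(M, R) is a finitely generated S-torsion right R-module; (3) if moreover pd_R(M) ≤ 1, then the right R-module Ext^1_R(M, R) also has projective dimension ≤ 1. -/
open CategoryTheory MulOpposite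

section Auxiliary

theorem exists_comp_eq_of_exact {R N F M X : Type*} [Ring R] [AddCommGroup N] [Module R N]
    [AddCommGroup F] [Module R F] [AddCommGroup M] [Module R M] [AddCommGroup X] [Module R X]
    {ι : N →ₗ[R] F} {π : F →ₗ[R] M} (hι : Function.Injective ι) (h : Function.Exact ι π)
    (φ : X →ₗ[R] F) (hφ : ∀ x, π (φ x) = 0) : ∃ ψ : X →ₗ[R] N, ∀ x, ι (ψ x) = φ x := by
  refine ⟨(LinearEquiv.ofInjective ι hι).symm.toLinearMap ∘ₗ
    φ.codRestrict (LinearMap.range ι) fun x => (h _).1 (hφ x), fun x => ?_⟩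
  exact congrArg Subtype.val ((LinearEquiv.ofInjective ι hι).apply_symm_apply _)

/-- A form of Schanuel's lemma. -/
theorem projective_of_projective_ker {R N P Q M : Type*} [Ring R] [AddCommGroup N] [Module R N]
    [AddCommGroup P] [Module R P] [AddCommGroup Q] [Module R Q] [AddCommGroup M] [Module R M]
    [Module.Projective R P] [Module.Projective R Q] {p : P →ₗ[R] M} {ι : N →ₗ[R] Q}
    {q : Q →ₗ[R] M} [Module.Projective R (LinearMap.ker p)] (hp : Function.Surjective p)
    (hι : Function.Injective ι) (hq : Function.Surjective q) (h : Function.Exact ι q) :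
    Module.Projective R N := by
  obtain ⟨α, hα⟩ := Module.projective_lifting_property q p hq
  obtain ⟨β, hβ⟩ := Module.projective_lifting_property p q hp
  replace hα : ∀ x, q (α x) = p x := LinearMap.congr_fun hα
  replace hβ : ∀ x, p (β x) = q x := LinearMap.congr_fun hβ
  obtain ⟨r, hr⟩ := exists_comp_eq_of_exact hι h
    (X := LinearMap.ker p × Q)
    ((α ∘ₗ (LinearMap.ker p).subtype).coprod (LinearMap.id - α ∘ₗ β)) (by
      rintro ⟨⟨x, hx⟩, y⟩
      simpa [hα, hβ] using hx)
  let i : N →ₗ[R] LinearMap.ker p × Q :=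
    ((β ∘ₗ ι).codRestrict (LinearMap.ker p) fun n => by
      simp [hβ, h.apply_apply_eq_zero]).prod ι
  refine Module.Projective.of_split i r (LinearMap.ext fun n => hι ?_)
  simp [hr, i]

theorem projective_ker_mkQ_comp {A G P F : Type*} [Ring A] [AddCommGroup G] [Module A G]
    [AddCommGroup P] [Module A P] [AddCommGroup F] [Module A F] [Module.Projective A G]
    [Module.Projective A P] [Module.Projective A F] {f : G →ₗ[A] P} {j : F →ₗ[A] P}
    (hf : Function.Surjective f) (hj : Function.Injective j) :
    Module.Projective A (LinearMap.ker ((LinearMap.range j).mkQ ∘ₗ f)) := by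
  set K := LinearMap.ker ((LinearMap.range j).mkQ ∘ₗ f)
  obtain ⟨σ, hσ⟩ := Module.projective_lifting_property f LinearMap.id hf
  replace hσ : ∀ x, f (σ x) = x := LinearMap.congr_fun hσ
  have hj' : Function.Exact j (LinearMap.range j).mkQ := by
    rw [LinearMap.exact_iff, Submodule.ker_mkQ]
  obtain ⟨ψ, hψ⟩ := exists_comp_eq_of_exact hj hj' (f ∘ₗ K.subtype) fun x => x.2
  let i : K →ₗ[A] G × F := (K.subtype - σ ∘ₗ f ∘ₗ K.subtype).prod ψ
  let r : G × F →ₗ[A] K :=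
    ((LinearMap.id - σ ∘ₗ f).coprod (σ ∘ₗ j)).codRestrict K (by
      rintro ⟨x, y⟩
      rw [LinearMap.mem_ker, LinearMap.comp_apply, Submodule.mkQ_apply,
        Submodule.Quotient.mk_eq_zero]
      exact ⟨y, by simp [hσ]⟩)
  refine Module.Projective.of_split i r (LinearMap.ext fun x => Subtype.ext ?_)
  have := hψ x
  simp only [LinearMap.comp_apply, Submodule.subtype_apply] at this
  simp [r, i, hσ, this]

/-- `R` as a right module over itself. -/
def rightSelfEquiv (R : Type) [Ring R] : Rᵐᵒᵖ ≃ₗ[Rᵐᵒᵖ] R where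
  __ := (opAddEquiv (α := R)).symm
  map_smul' _ _ := rfl

/-- The dual of a finite free left module is a finite free right module. -/
noncomputable def dualFreeEquiv (R : Type) [Ring R] (k : ℕ) :
    (Fin k → Rᵐᵒᵖ) ≃ₗ[Rᵐᵒᵖ] ((Fin k → R) →ₗ[R] R) :=
  (LinearEquiv.piCongrRight fun _ => rightSelfEquiv R).trans
    ((Pi.basisFun R (Fin k)).constr Rᵐᵒᵖ)

theorem precompDual_injective {R N F : Type} [Ring R] [AddCommGroup N] [Module R N]
    [AddCommGroup F] [Module R F] {p : F →ₗ[R] N} (hp : Function.Surjective p) :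
    Function.Injective (precompDual R p) :=
  fun _ _ h => LinearMap.ext fun x => by
    obtain ⟨y, rfl⟩ := hp x
    exact LinearMap.congr_fun h y

theorem projective_dual {R N : Type} [Ring R] [AddCommGroup N] [Module R N] {m : ℕ}
    [Module.Projective R N] {p : (Fin m → R) →ₗ[R] N} (hp : Function.Surjective p) :
    ∃ f : (Fin m → Rᵐᵒᵖ) →ₗ[Rᵐᵒᵖ] (N →ₗ[R] R),
      Function.Surjective f ∧ Module.Projective Rᵐᵒᵖ (N →ₗ[R] R) := by
  obtain ⟨s, hs⟩ := Module.projective_lifting_property p LinearMap.id hp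
  have hid : precompDual R s ∘ₗ precompDual R p = LinearMap.id :=
    LinearMap.ext fun g => LinearMap.ext fun x => congrArg g (LinearMap.congr_fun hs x)
  have : Module.Projective Rᵐᵒᵖ ((Fin m → R) →ₗ[R] R) :=
    Module.Projective.of_equiv (dualFreeEquiv R m)
  refine ⟨precompDual R s ∘ₗ (dualFreeEquiv R m).toLinearMap, ?_,
    Module.Projective.of_split _ _ hid⟩
  rw [LinearMap.coe_comp]
  exact (LinearMap.surjective_of_comp_eq_id _ _ hid).comp (dualFreeEquiv R m).surjective

theorem nonempty_extOneDual_span_singleton_equiv {R N F : Type} [Ring R] [AddCommGroup N]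
    [Module R N] [AddCommGroup F] [Module R F] [Module.Projective R F] {f : R}
    (hf : f ∈ nonZeroDivisors R) {ι : N →ₗ[R] F} {π : F →ₗ[R] (R ⧸ Submodule.span R {f})}
    (hι : Function.Injective ι) (hπ : Function.Surjective π) (h : Function.Exact ι π) :
    Nonempty (ExtOneDual R ι ≃ₗ[Rᵐᵒᵖ] (R ⧸ (Submodule.span Rᵐᵒᵖ {f} : Submodule Rᵐᵒᵖ R))) := by
  have hcancel : Function.Injective (LinearMap.toSpanSingleton R R f) := by
    rw [injective_iff_map_eq_zero]
    exact fun x hx => hf.2 x hx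
  have hexact : Function.Exact (LinearMap.toSpanSingleton R R f) (Submodule.span R {f}).mkQ := by
    rw [LinearMap.exact_iff, Submodule.ker_mkQ, LinearMap.range_toSpanSingleton]
  obtain ⟨β, hβ⟩ := Module.projective_lifting_property (Submodule.span R {f}).mkQ π
    (Submodule.mkQ_surjective _)
  replace hβ : ∀ x, Submodule.Quotient.mk (β x) = π x := LinearMap.congr_fun hβ
  obtain ⟨γ, hγ⟩ := exists_comp_eq_of_exact hcancel hexact (β ∘ₗ ι) fun n =>
    (hβ _).trans (h.apply_apply_eq_zero n)
  replace hγ : ∀ n, γ n * f = β (ι n) := hγ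
  obtain ⟨e, he⟩ := hπ (Submodule.Quotient.mk 1)
  have hπβ : ∀ x, π x = β x • π e := fun x => by
    rw [← hβ x, he, ← Submodule.Quotient.mk_smul, smul_eq_mul, mul_one]
  obtain ⟨ν, hν⟩ := exists_comp_eq_of_exact hι h
    (LinearMap.id - (LinearMap.toSpanSingleton R F e) ∘ₗ β) fun x => by
      simp [← hπβ]
  replace hν : ∀ x, ι (ν x) = x - β x • e := hν
  obtain ⟨n₀, hn₀⟩ := (h (f • e)).1 (by
    rw [map_smul, he, ← Submodule.Quotient.mk_smul, Submodule.Quotient.mk_eq_zero]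
    exact Submodule.mem_span_singleton.2 ⟨1, by simp⟩)
  obtain ⟨d, hd⟩ := Submodule.mem_span_singleton.1
    ((Submodule.Quotient.eq _).1 ((hβ e).trans he))
  have hγn₀ : γ n₀ = 1 + f * d := by
    refine hcancel ?_
    simp only [LinearMap.toSpanSingleton_apply, smul_eq_mul, hγ, hn₀, map_smul]
    rw [sub_eq_iff_eq_add.1 hd.symm, smul_eq_mul]
    noncomm_ring
  have hspan : ∀ a : R, a ∈ (Submodule.span Rᵐᵒᵖ {f} : Submodule Rᵐᵒᵖ R) ↔ ∃ b, f * b = a :=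
    fun a => Submodule.mem_span_singleton.trans ⟨fun ⟨b, hb⟩ => ⟨b.unop, hb⟩,
      fun ⟨b, hb⟩ => ⟨op b, hb⟩⟩
  let ev : (N →ₗ[R] R) →ₗ[Rᵐᵒᵖ] R ⧸ (Submodule.span Rᵐᵒᵖ {f} : Submodule Rᵐᵒᵖ R) :=
    (Submodule.span Rᵐᵒᵖ {f} : Submodule Rᵐᵒᵖ R).mkQ ∘ₗ
      { toFun := fun g => g n₀, map_add' := fun _ _ => rfl, map_smul' := fun _ _ => rfl }
  have hev : ∀ g, ev g = Submodule.Quotient.mk (g n₀) := fun _ => rfl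
  have hsurj : Function.Surjective ev := fun y => by
    obtain ⟨a, rfl⟩ := Submodule.Quotient.mk_surjective _ y
    refine ⟨op a • γ, (Submodule.Quotient.eq _).2 ((hspan _).2 ⟨d * a, ?_⟩)⟩
    change _ = γ n₀ * a - a
    rw [hγn₀]
    noncomm_ring
  have hker : LinearMap.range (precompDual R ι) = LinearMap.ker ev := by
    ext g
    rw [LinearMap.mem_ker, hev, Submodule.Quotient.mk_eq_zero, hspan]
    constructor
    · rintro ⟨φ, rfl⟩
      refine ⟨φ e, ?_⟩
      change _ = φ (ι n₀)
      rw [hn₀, map_smul, smul_eq_mul]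
    · rintro ⟨b, hb⟩
      refine ⟨g ∘ₗ ν + LinearMap.toSpanSingleton R R b ∘ₗ β, LinearMap.ext fun n => ?_⟩
      have hn : ν (ι n) = n - γ n • n₀ := hι (by
        rw [hν, map_sub, map_smul, hn₀, ← hγ, mul_smul])
      change g (ν (ι n)) + β (ι n) * b = g n
      rw [hn, map_sub, map_smul, ← hγ, ← hb, smul_eq_mul, mul_assoc, sub_add_cancel]
  exact ⟨(Submodule.quotEquivOfEq _ _ hker).trans (ev.quotKerEquivOfSurjective hsurj)⟩

/-- Finitely many elements of `R` have a common left denominator: for `s i ∈ S` and `a i : R`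
there is `t ∈ S` with `t * a i ∈ R * s i` for all `i`. -/
theorem exists_common_left_multiple {R α : Type*} [Ring R] [Finite α] {S : Submonoid R}
    (hS : ∀ f ∈ S, ∀ a : R, ∃ r : R, ∃ s ∈ S, r * f = s * a) (s a : α → R)
    (hs : ∀ i, s i ∈ S) : ∃ t ∈ S, ∃ r : α → R, ∀ i, r i * s i = t * a i := by
  classical
  cases nonempty_fintype α
  suffices H : ∀ A : Finset α, ∃ t ∈ S, ∀ i ∈ A, ∃ r, r * s i = t * a i by
    obtain ⟨t, ht, h⟩ := H Finset.univ
    choose r hr using fun i => h i (Finset.mem_univ i)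
    exact ⟨t, ht, r, hr⟩
  intro A
  induction A using Finset.induction_on with
  | empty => exact ⟨1, S.one_mem, by simp⟩
  | insert j A _ ih =>
    obtain ⟨t, ht, h⟩ := ih
    obtain ⟨r, u, hu, hr⟩ := hS (s j) (hs j) (t * a j)
    refine ⟨u * t, S.mul_mem hu ht, fun i hi => ?_⟩
    obtain rfl | hi := Finset.mem_insert.1 hi
    · exact ⟨r, by rw [hr, mul_assoc]⟩
    · obtain ⟨r', hr'⟩ := h i hi
      exact ⟨u * r', by rw [mul_assoc, hr', mul_assoc]⟩

/-- Right-handed version of `exists_common_left_multiple`. -/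
theorem exists_common_right_multiple {R α : Type*} [Ring R] [Finite α] {S : Submonoid R}
    (hS : ∀ f ∈ S, ∀ a : R, ∃ r : R, ∃ s ∈ S, f * r = a * s) (s a : α → R)
    (hs : ∀ i, s i ∈ S) : ∃ t ∈ S, ∃ r : α → R, ∀ i, s i * r i = a i * t := by
  obtain ⟨t, ht, r, hr⟩ := exists_common_left_multiple (R := Rᵐᵒᵖ) (S := S.op)
    (fun f hf a => by
      obtain ⟨r, s, hs, h⟩ := hS f.unop hf a.unop
      exact ⟨op r, op s, hs, unop_injective h⟩)
    (fun i => op (s i)) (fun i => op (a i)) hs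
  exact ⟨t.unop, ht, fun i => (r i).unop, fun i => op_injective (hr i)⟩

theorem exists_op_smul_extOneDual_eq_zero {R N M : Type} [Ring R] {S : Submonoid R}
    (hS : IsOreSet R S) [AddCommGroup N] [Module R N] [AddCommGroup M] [Module R M]
    (hM : STorsion R S M) {k : ℕ} {ι : N →ₗ[R] (Fin k → R)} {π : (Fin k → R) →ₗ[R] M}
    (hι : Function.Injective ι) (h : Function.Exact ι π) (x : ExtOneDual R ι) :
    ∃ s ∈ S, op s • x = 0 := by
  obtain ⟨g, rfl⟩ := Submodule.Quotient.mk_surjective _ x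
  choose s hs hsπ using fun i : Fin k => hM (π (Pi.single i 1))
  choose n hn using fun i => (h (s i • Pi.single i 1)).1 (by rw [map_smul, hsπ])
  obtain ⟨u, hu, r', hr'⟩ := exists_common_right_multiple hS.2.1 s (fun i => g (n i)) hs
  refine ⟨u, hu, ?_⟩
  rw [← Submodule.Quotient.mk_smul, Submodule.Quotient.mk_eq_zero]
  let φ : (Fin k → R) →ₗ[R] R := (Pi.basisFun R (Fin k)).constr ℕ r'
  have hφ : ∀ i, φ (Pi.single i 1) = r' i := fun i => by
    rw [← Pi.basisFun_apply]
    exact (Pi.basisFun R (Fin k)).constr_basis ℕ r' i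
  have hφn : ∀ i, φ (ι (n i)) = g (n i) * u := fun i => by
    rw [hn, map_smul, hφ, smul_eq_mul, hr']
  refine ⟨φ, LinearMap.ext fun y => ?_⟩
  change φ (ι y) = g y * u
  obtain ⟨t, ht, r, hr⟩ := exists_common_left_multiple hS.2.2 s (ι y) hs
  have hty : t • y = ∑ i, r i • n i := hι (by
    rw [map_smul, map_sum]
    ext j
    simp [hn, Finset.sum_apply, Pi.single_apply, hr])
  refine sub_eq_zero.1 ((hS.1 ht).1 _ ?_)
  rw [mul_sub, sub_eq_zero, ← mul_assoc, ← smul_eq_mul, ← smul_eq_mul t, ← map_smul, ← map_smul,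
    ← map_smul, hty]
  simp [hφn, Finset.sum_mul, mul_assoc]

theorem precompDual_injective_of_torsion {R N F M : Type} [Ring R] {S : Submonoid R}
    (hS : S ≤ nonZeroDivisors R) [AddCommGroup N] [Module R N] [AddCommGroup F] [Module R F]
    [AddCommGroup M] [Module R M] (hM : STorsion R S M) {ι : N →ₗ[R] F} {π : F →ₗ[R] M}
    (h : Function.Exact ι π) : Function.Injective (precompDual R ι) := by
  rw [injective_iff_map_eq_zero]
  refine fun φ hφ => LinearMap.ext fun x => ?_
  obtain ⟨s, hs, hsx⟩ := hM (π x)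
  obtain ⟨n, hn⟩ := (h (s • x)).1 (by rw [map_smul, hsx])
  refine (hS hs).1 _ ?_
  rw [← smul_eq_mul, ← map_smul, ← hn]
  exact LinearMap.congr_fun hφ n

end Auxiliary

/-- Over a left and right noetherian ring `R` with an Ore set `S` of
non-zero-divisors:
(1) for `f ∈ S`, `Ext^1_R(R/Rf, R) ≅ R/fR` as right `R`-modules (here `Ext^1` is computed
as the cokernel `ExtOneDual` of `Hom(F, R) → Hom(N, R)` for any presentation
`0 → N → F → M → 0` with `F` finite free);
(2) for `M` a finitely generated `S`-torsion left `R`-module, `Ext^1_R(M, R)` is a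
finitely generated `S`-torsion right `R`-module;
(3) if moreover `pd_R(M) ≤ 1`, then the right `R`-module `Ext^1_R(M, R)` has projective
dimension `≤ 1`. -/
theorem statement5
    (R : Type) [Ring R] [IsNoetherianRing R] [IsNoetherianRing Rᵐᵒᵖ]
    (S : Submonoid R) (hS : IsOreSet R S) :
    (∀ f ∈ S, ∀ (k : ℕ) (N : Type) [AddCommGroup N] [Module R N]
      (ι : N →ₗ[R] (Fin k → R))
      (π : (Fin k → R) →ₗ[R] (R ⧸ (Submodule.span R {f}))),
      Function.Injective ι → Function.Surjective π → Function.Exact ι π →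
        Nonempty ((ExtOneDual R ι) ≃ₗ[Rᵐᵒᵖ]
          (R ⧸ (Submodule.span Rᵐᵒᵖ {f} : Submodule Rᵐᵒᵖ R)))) ∧
    (∀ (M : Type) [AddCommGroup M] [Module R M], MemM R S M →
      ∀ (k : ℕ) (N : Type) [AddCommGroup N] [Module R N]
        (ι : N →ₗ[R] (Fin k → R)) (π : (Fin k → R) →ₗ[R] M),
        Function.Injective ι → Function.Surjective π → Function.Exact ι π →
          (Module.Finite Rᵐᵒᵖ (ExtOneDual R ι) ∧
            (∀ x : ExtOneDual R ι, ∃ s ∈ S, (op s) • x = 0)) ∧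
          (PdLE R 1 M → PdLE Rᵐᵒᵖ 1 (ExtOneDual R ι))) := by
  refine ⟨fun f hf k N _ _ ι π hι hπ h =>
    nonempty_extOneDual_span_singleton_equiv (hS.1 hf) hι hπ h,
    fun M _ _ hM k N _ _ ι π hι hπ h => ?_⟩
  have : IsNoetherian R N := isNoetherian_of_injective ι hι
  obtain ⟨m, p, hp⟩ := Module.Finite.exists_fin' R N
  refine ⟨⟨?_, exists_op_smul_extOneDual_eq_zero hS hM.2 hι h⟩, ?_⟩
  · have : IsNoetherian Rᵐᵒᵖ ((Fin m → R) →ₗ[R] R) :=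
      isNoetherian_of_linearEquiv (dualFreeEquiv R m)
    have : IsNoetherian Rᵐᵒᵖ (N →ₗ[R] R) :=
      isNoetherian_of_injective (precompDual R p) (precompDual_injective hp)
    infer_instance
  · rintro ⟨l, q, hq, hqker⟩
    have : Module.Projective R (LinearMap.ker q) := hqker
    have : Module.Projective R N := projective_of_projective_ker hq hι hπ h
    have : Module.Projective Rᵐᵒᵖ ((Fin k → R) →ₗ[R] R) :=
      Module.Projective.of_equiv (dualFreeEquiv R k)
    obtain ⟨f, hf, _⟩ := projective_dual hp
    exact ⟨m, (LinearMap.range (precompDual R ι)).mkQ ∘ₗ f,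
      (Submodule.mkQ_surjective _).comp hf,
      projective_ker_mkQ_comp hf (precompDual_injective_of_torsion hS.1 hM.2 h)⟩
end

section
/- Let R be a left and right noetherian ring satisfying: there is an integer d(R) such that Ext^i_R(N, R) = 0 for every finitely generated left or right R-module N and every i > d(R). Suppose a finitely generated left R-module M fits into an exact sequence 0 → M → F_0 → F_1 → F_2 → ⋯ in which every F_j is a finitely generated free R-module. Then Ext^i_R(M, R) = 0 for all i > 0. -/
open CategoryTheory MulOpposite

/-- The `Ext` functors obtained by deriving `Hom` in its first variable vanish in the same
positive degrees as the `Ext` groups of the derived category. -/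
lemma subsingleton_ext_succ_iff {C : Type*} [Category* C] [Abelian C] [EnoughProjectives C]
    [HasExt C] (X Y : C) (n : ℕ) :
    Subsingleton (((_root_.Ext ℤ C (n + 1)).obj (Opposite.op X)).obj Y) ↔
      Subsingleton (Abelian.Ext X Y (n + 1)) := by
  let P : ProjectiveResolution X := ProjectiveResolution.of X
  have hExact : (P.complex.linearYonedaObj ℤ Y).ExactAt (n + 1) ↔
      ∀ g : P.complex.X (n + 1) ⟶ Y, P.complex.d (n + 2) (n + 1) ≫ g = 0 →
        ∃ h : P.complex.X n ⟶ Y, P.complex.d (n + 1) n ≫ h = g := by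
    rw [HomologicalComplex.exactAt_iff' _ n (n + 1) (n + 2) (by simp) (by simp),
      ShortComplex.moduleCat_exact_iff]
    rfl
  rw [← ModuleCat.isZero_iff_subsingleton, (P.isoExt (R := ℤ) (n + 1) Y).isZero_iff,
    ← HomologicalComplex.exactAt_iff_isZero_homology, hExact]
  constructor
  · intro H
    refine subsingleton_of_forall_eq 0 fun α ↦ ?_
    obtain ⟨g, hg, rfl⟩ := P.extMk_surjective α (n + 2) rfl
    exact (P.extMk_eq_zero_iff g (n + 2) rfl hg n rfl).2 (H g hg)
  · intro _ g hg
    exact (P.extMk_eq_zero_iff g (n + 2) rfl hg n rfl).1 (Subsingleton.elim _ _)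

/-- Dimension shifting along `0 → A → P → range b → 0` with `P` projective. -/
lemma ExtRVanish.of_range {R : Type} [Ring R] {A P Q : Type} [AddCommGroup A] [Module R A]
    [AddCommGroup P] [Module R P] [Module.Projective R P] [AddCommGroup Q] [Module R Q]
    {a : A →ₗ[R] P} {b : P →ₗ[R] Q} (ha : Function.Injective a) (hab : Function.Exact a b)
    {i : ℕ} (hi : 1 ≤ i) (h : ExtRVanish R (LinearMap.range b) (i + 1)) :
    ExtRVanish R A i := by
  obtain ⟨n, rfl⟩ := Nat.exists_eq_add_of_le' hi
  have hab' : Function.Exact a b.rangeRestrict := fun x ↦ by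
    rw [← hab x, ← Subtype.coe_inj]
    rfl
  let S : ShortComplex (ModuleCat R) :=
    ShortComplex.mk (ModuleCat.ofHom a) (ModuleCat.ofHom b.rangeRestrict)
      (ModuleCat.hom_ext hab'.linearMap_comp_eq_zero)
  have hS : S.ShortExact :=
    { exact := (ShortComplex.ShortExact.moduleCat_exact_iff_function_exact S).2 hab'
      mono_f := (ModuleCat.mono_iff_injective _).2 ha
      epi_g := (ModuleCat.epi_iff_surjective _).2 b.surjective_rangeRestrict }
  have : Projective S.X₂ := (IsProjective.iff_projective P).1 inferInstance
  have : Subsingleton (Abelian.Ext S.X₃ (ModuleCat.of R R) (n + 1 + 1)) :=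
    (subsingleton_ext_succ_iff _ _ _).1 h
  refine (subsingleton_ext_succ_iff _ _ _).2 (subsingleton_of_forall_eq 0 fun x ↦ ?_)
  obtain ⟨y, rfl⟩ := Abelian.Ext.contravariant_sequence_exact₁ hS _ x (add_comm 1 (n + 1))
    (Subsingleton.elim _ _)
  rw [y.eq_zero_of_projective, Abelian.Ext.comp_zero]

/-- Let `R` be left and right noetherian satisfying Assumption (⋆).
If a finitely generated left `R`-module `M` embeds in an exact sequence
`0 → M → F₀ → F₁ → F₂ → ⋯` of finitely generated free modules, then
`Ext^i_R(M, R) = 0` for all `i > 0`. -/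
theorem statement6
    (R : Type) [Ring R] [IsNoetherianRing R] [IsNoetherianRing Rᵐᵒᵖ]
    (hstar : AssumptionStar R)
    (M : Type) [AddCommGroup M] [Module R M] (hfg : Module.Finite R M)
    (k : ℕ → ℕ) (ι : M →ₗ[R] (Fin (k 0) → R))
    (f : ∀ i : ℕ, (Fin (k i) → R) →ₗ[R] (Fin (k (i+1)) → R))
    (hι : Function.Injective ι) (h0 : Function.Exact ι (f 0))
    (hf : ∀ i, Function.Exact (f i) (f (i+1))) :
    ∀ i, 1 ≤ i → ExtRVanish R M i := by
  obtain ⟨d, hd, -⟩ := hstar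
  have hrange : ∀ n i j : ℕ, d < i + n → 1 ≤ i → ExtRVanish R (LinearMap.range (f j)) i := by
    intro n
    induction n with
    | zero => exact fun i j hdi _ ↦ hd _ inferInstance i hdi
    | succ n ih =>
      intro i j hdi hi
      refine ExtRVanish.of_range (Submodule.injective_subtype _) ?_ hi
        (ih (i + 1) (j + 1) (by lia) (by lia))
      rw [LinearMap.exact_iff, Submodule.range_subtype]
      exact (hf j).linearMap_ker_eq
  intro i hi
  exact ExtRVanish.of_range hι h0 hi (hrange d (i + 1) 0 (by lia) (by lia))
end
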